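/- arXiv:1803.03901 — 5 statements merged into one kernel-verified Lean document; each statement's English description precedes it below -/
import Mathlib

section
/- Let 1 < p < ∞ and K ≥ 1. The set of all u ∈ L^p([0,1]) for which there exist change points 0 ≤ x₁ ≤ … ≤ x_K ≤ 1 such that either χ_x(t)·u(t) ≥ 0 for almost every t ∈ [0,1] or χ_x(t)·u(t) ≤ 0 for almost every t ∈ [0,1] is a closed subset of L^p([0,1]). -/
open MeasureTheory

open Classical in
/-- Sign function `χ_x` associated to change points `0 = x 0 ≤ x 1 ≤ … ≤ x K ≤ x (K+1) = 1`:
`χ_x t = (-1)^k` for `x k < t < x (k+1)` (`k = 0, …, K`), `χ_x` vanishes at interior change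
points, and at the endpoints `0` and `1` it takes the sign of the adjacent nondegenerate
interval. -/
noncomputable def chgSign (K : ℕ) (x : ℕ → ℝ) (t : ℝ) : ℝ :=
  if h : ∃ k, k ≤ K ∧ x k < t ∧ t < x (k + 1) then (-1 : ℝ) ^ Nat.find h
  else if t = 0 then
    if h0 : ∃ k, k ≤ K ∧ (0 : ℝ) < x (k + 1) then (-1 : ℝ) ^ Nat.find h0 else 0
  else if t = 1 then
    if h1 : ∃ j, j ≤ K ∧ x (K - j) < 1 then (-1 : ℝ) ^ (K - Nat.find h1) else 0
  else 0

/-- The change point inequalities, tested on each open interval separately and with a global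
sign `s`. -/
def HasSignPattern (K : ℕ) (s : ℝ) (x : ℕ → ℝ) (u : ℝ → ℝ) (t : ℝ) : Prop :=
  ∀ k ≤ K, x k < t → t < x (k + 1) → 0 ≤ s * ((-1) ^ k * u t)

lemma le_of_le_succ_upto {K : ℕ} {x : ℕ → ℝ} (hx : ∀ k ≤ K, x k ≤ x (k + 1)) {a b : ℕ}
    (hab : a ≤ b) (hb : b ≤ K + 1) : x a ≤ x b := by
  induction b, hab using Nat.le_induction with
  | base => exact le_rfl
  | succ n _ ih => exact (ih (by omega)).trans (hx n (by omega))

lemma chgSign_of_mem_interval {K : ℕ} {x : ℕ → ℝ} (hx : ∀ k ≤ K, x k ≤ x (k + 1)) {k : ℕ}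
    (hk : k ≤ K) {t : ℝ} (h1 : x k < t) (h2 : t < x (k + 1)) : chgSign K x t = (-1) ^ k := by
  classical
  have h : ∃ k, k ≤ K ∧ x k < t ∧ t < x (k + 1) := ⟨k, hk, h1, h2⟩
  have hfind : Nat.find h = k := by
    obtain ⟨_, hj1, hj2⟩ := Nat.find_spec h
    refine le_antisymm (Nat.find_min' h ⟨hk, h1, h2⟩) (not_lt.1 fun hlt => ?_)
    have := le_of_le_succ_upto hx (Nat.succ_le_of_lt hlt) (by omega)
    exact absurd (hj2.trans_le this) h1.not_gt
  rw [chgSign, dif_pos h]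
  convert rfl
  exact hfind.symm

lemma exists_mem_interval {K : ℕ} {x : ℕ → ℝ} (h0 : x 0 = 0) (h1 : x (K + 1) = 1) {t : ℝ}
    (ht : t ∈ Set.Icc (0 : ℝ) 1) (hne : t ∉ Set.range x) :
    ∃ k ≤ K, x k < t ∧ t < x (k + 1) := by
  classical
  have hne' : ∀ k, x k ≠ t := fun k hk => hne ⟨k, hk⟩
  have hex : ∃ k, t < x k :=
    ⟨K + 1, lt_of_le_of_ne (h1 ▸ ht.2) (hne' _).symm⟩
  have hle : Nat.find hex ≤ K + 1 :=
    Nat.find_min' hex (lt_of_le_of_ne (h1 ▸ ht.2) (hne' _).symm)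
  have hspec := Nat.find_spec hex
  have hmin := fun m => Nat.find_min hex (m := m)
  rcases hn : Nat.find hex with _ | k
  · rw [hn, h0] at hspec
    exact absurd ht.1 hspec.not_ge
  · rw [hn] at hle hspec hmin
    exact ⟨k, by omega, lt_of_le_of_ne (not_lt.1 (hmin k (Nat.lt_succ_self k))) (hne' k), hspec⟩

lemma ae_chgSign_iff {K : ℕ} {x : ℕ → ℝ} (h0 : x 0 = 0) (h1 : x (K + 1) = 1)
    (hx : ∀ k ≤ K, x k ≤ x (k + 1)) (s : ℝ) (u : ℝ → ℝ) :
    (∀ᵐ t ∂(volume.restrict (Set.Icc (0 : ℝ) 1)), 0 ≤ s * (chgSign K x t * u t)) ↔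
      ∀ᵐ t ∂(volume.restrict (Set.Icc (0 : ℝ) 1)), HasSignPattern K s x u t := by
  constructor <;> intro h
  · filter_upwards [h] with t ht k hk hk1 hk2
    rwa [chgSign_of_mem_interval hx hk hk1 hk2] at ht
  · filter_upwards [h, ae_restrict_mem measurableSet_Icc,
      (Set.countable_range x).ae_notMem (volume.restrict (Set.Icc (0 : ℝ) 1))] with t ht htI htx
    obtain ⟨k, hk, hk1, hk2⟩ := exists_mem_interval h0 h1 htI htx
    rw [chgSign_of_mem_interval hx hk hk1 hk2]
    exact ht k hk hk1 hk2

/-- The vectors of change points, extended by values in `[0,1]`. -/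
def changePoints (K : ℕ) : Set (ℕ → ℝ) :=
  {x | (x 0 = 0 ∧ x (K + 1) = 1 ∧ ∀ k ≤ K, x k ≤ x (k + 1)) ∧ ∀ k, x k ∈ Set.Icc (0 : ℝ) 1}

lemma isCompact_changePoints (K : ℕ) : IsCompact (changePoints K) := by
  have hpi : IsCompact (Set.univ.pi fun _ : ℕ => Set.Icc (0 : ℝ) 1) :=
    isCompact_univ_pi fun _ => isCompact_Icc
  have hclosed : IsClosed {x : ℕ → ℝ | x 0 = 0 ∧ x (K + 1) = 1 ∧ ∀ k ≤ K, x k ≤ x (k + 1)} := by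
    have hmono : IsClosed {x : ℕ → ℝ | ∀ k ≤ K, x k ≤ x (k + 1)} := by
      simp only [Set.ofPred_forall]
      exact isClosed_iInter fun k => isClosed_iInter fun _ =>
        isClosed_le (continuous_apply k) (continuous_apply (k + 1))
    exact (isClosed_eq (continuous_apply 0) continuous_const).inter
      ((isClosed_eq (continuous_apply (K + 1)) continuous_const).inter hmono)
  convert hpi.inter_left hclosed using 1
  ext x
  exact and_congr_right' Set.mem_univ_pi.symm

/-- Values of `x` beyond the index `K + 1` can be replaced so that they lie in `[0,1]`. -/
lemma min_comp_mem_changePoints {K : ℕ} {x : ℕ → ℝ} (h0 : x 0 = 0) (h1 : x (K + 1) = 1)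
    (hx : ∀ k ≤ K, x k ≤ x (k + 1)) : (fun k => x (min k (K + 1))) ∈ changePoints K := by
  refine ⟨⟨by simpa using h0, by simpa using h1, fun k _ => ?_⟩, fun k => ⟨?_, ?_⟩⟩
  · exact le_of_le_succ_upto hx (by omega) (by omega)
  · exact h0 ▸ le_of_le_succ_upto hx (Nat.zero_le _) (by omega)
  · exact (le_of_le_succ_upto hx (min_le_right _ _) le_rfl).trans_eq h1

lemma HasSignPattern.of_tendsto {K : ℕ} {s t : ℝ} {X : ℕ → ℕ → ℝ} {U : ℕ → ℝ → ℝ}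
    {x : ℕ → ℝ} {u : ℝ → ℝ} (h : ∀ n, HasSignPattern K s (X n) (U n) t)
    (hX : Filter.Tendsto X Filter.atTop (nhds x))
    (hU : Filter.Tendsto (fun n => U n t) Filter.atTop (nhds (u t))) :
    HasSignPattern K s x u t := by
  intro k hk h1 h2
  rw [tendsto_pi_nhds] at hX
  refine ge_of_tendsto ((hU.const_mul ((-1) ^ k)).const_mul s) ?_
  filter_upwards [(hX k).eventually_lt_const h1, (hX (k + 1)).eventually_const_lt h2]
    with n hn1 hn2
  exact h n k hk hn1 hn2

lemma isClosed_hasSignPattern (p : ENNReal) [Fact (1 ≤ p)] (μ : Measure ℝ) (K : ℕ) (s : ℝ) :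
    IsClosed {u : Lp ℝ p μ | ∃ x ∈ changePoints K, ∀ᵐ t ∂μ, HasSignPattern K s x u t} := by
  refine IsSeqClosed.isClosed fun U u hU hlim => ?_
  choose X hXmem hX using hU
  obtain ⟨x, hxmem, φ, hφ, hXφ⟩ := (isCompact_changePoints K).tendsto_subseq hXmem
  obtain ⟨ψ, hψ, hUψ⟩ :=
    (tendstoInMeasure_of_tendsto_Lp (hlim.comp hφ.tendsto_atTop)).exists_seq_tendsto_ae
  refine ⟨x, hxmem, ?_⟩
  filter_upwards [hUψ, ae_all_iff.2 hX] with t htU htX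
  exact HasSignPattern.of_tendsto (fun n => htX (φ (ψ n))) (hXφ.comp hψ.tendsto_atTop) htU

lemma exists_chgSign_iff (K : ℕ) (s : ℝ) (u : ℝ → ℝ) :
    (∃ x : ℕ → ℝ, x 0 = 0 ∧ x (K + 1) = 1 ∧ (∀ k ≤ K, x k ≤ x (k + 1)) ∧
      ∀ᵐ t ∂(volume.restrict (Set.Icc (0 : ℝ) 1)), 0 ≤ s * (chgSign K x t * u t)) ↔
    ∃ x ∈ changePoints K,
      ∀ᵐ t ∂(volume.restrict (Set.Icc (0 : ℝ) 1)), HasSignPattern K s x u t := by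
  constructor
  · rintro ⟨x, h0, h1, hx, h⟩
    refine ⟨_, min_comp_mem_changePoints h0 h1 hx, ?_⟩
    filter_upwards [(ae_chgSign_iff h0 h1 hx s u).1 h] with t ht k hk hk1 hk2
    beta_reduce at hk1 hk2
    rw [min_eq_left (by omega)] at hk1 hk2
    exact ht k hk hk1 hk2
  · rintro ⟨x, ⟨⟨h0, h1, hx⟩, _⟩, h⟩
    exact ⟨x, h0, h1, hx, (ae_chgSign_iff h0 h1 hx s u).2 h⟩

/-- The class `V^{K,m}_{m,p}` of functions with at most `K` change points
of `m`-convexity — i.e. the set of `u ∈ L^p([0,1])` for which there exist change points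
`0 ≤ x₁ ≤ … ≤ x_K ≤ 1` such that `χ_x u ≥ 0` a.e. or `χ_x u ≤ 0` a.e. —
is closed in `L^p([0,1])`. -/
theorem union_of_cones_closed (p : ENNReal) (hp1 : 1 < p) [Fact (1 ≤ p)] (hp2 : p ≠ ⊤)
    (K : ℕ) (hK : 1 ≤ K) :
    IsClosed {u : Lp ℝ p (volume.restrict (Set.Icc (0 : ℝ) 1)) |
      ∃ x : ℕ → ℝ, x 0 = 0 ∧ x (K + 1) = 1 ∧ (∀ k ≤ K, x k ≤ x (k + 1)) ∧
        ((∀ᵐ t ∂(volume.restrict (Set.Icc (0 : ℝ) 1)), 0 ≤ chgSign K x t * (u : ℝ → ℝ) t) ∨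
         (∀ᵐ t ∂(volume.restrict (Set.Icc (0 : ℝ) 1)), chgSign K x t * (u : ℝ → ℝ) t ≤ 0))} := by
  have h := (isClosed_hasSignPattern p (volume.restrict (Set.Icc (0 : ℝ) 1)) K 1).union
    (isClosed_hasSignPattern p (volume.restrict (Set.Icc (0 : ℝ) 1)) K (-1))
  convert h using 1
  ext u
  simp only [Set.mem_union, Set.mem_ofPred_eq, ← exists_chgSign_iff, ← exists_or, ← and_or_left,
    one_mul, neg_one_mul, Left.nonneg_neg_iff]
end

section
/- Let m ≥ 1 and 0 ≤ ℓ < m be integers, K ≥ 0, and fix change points 0 = x₀ ≤ x₁ ≤ … ≤ x_K ≤ x_{K+1} = 1 with associated sign function χ_x. Suppose g : ℝ → ℝ is (2m−ℓ) times continuously differentiable on [0,1] and satisfies: (a) (−1)^{m−ℓ} χ_x(t) g^(2m−ℓ)(t) ≤ 0 for all t ∈ [0,1]; (b) g^(j)(0) = 0 for j = 0,…,ℓ−1; (c) g^(m−1−j)(0) = (−1)^j g^(m+j)(0) for j = 0,…,m−ℓ−2; (d) g^(m+j)(1) = 0 for j = 0,…,m−ℓ−2; (e) (−1)^{m−ℓ}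 χ_x(1) g^(2m−ℓ−1)(1) ≥ 0; and (f) χ_x(0)·[ g^(ℓ)(0) + (−1)^{m−ℓ} g^(2m−ℓ−1)(0) ] ≤ 0. Then for every f : ℝ → ℝ that is m times continuously differentiable on [0,1] and satisfies (−1)^{k−1} f^(ℓ)(t) ≥ 0 for all t ∈ [x_{k−1}, x_k] and all k = 1,…,K+1, one has ⟪g,f⟫ ≤ 0. That is, every such g belongs to the negative polar cone of V^{K,ℓ}[x]. -/
/-- The duality pairing `⟪g,f⟫ = ∑_{j<m} g^(j)(0) f^(j)(0) + ∫₀¹ f^(m)(t) g^(m)(t) dt`. -/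
noncomputable def dualPairing (m : ℕ) (g f : ℝ → ℝ) : ℝ :=
  (∑ j ∈ Finset.range m,
      iteratedDerivWithin j g (Set.Icc 0 1) 0 * iteratedDerivWithin j f (Set.Icc 0 1) 0)
    + ∫ t in (0 : ℝ)..1,
        iteratedDerivWithin m f (Set.Icc 0 1) t * iteratedDerivWithin m g (Set.Icc 0 1) t

open Set in
/-- Away from interior change points, `chgSign K x t` is the sign attached to some interval
`[x k, x (k + 1)]` containing `t`. -/
theorem exists_chgSign_eq_neg_one_pow {K : ℕ} {x : ℕ → ℝ} (hx0 : x 0 = 0) (hxK : x (K + 1) = 1)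
    (hmono : ∀ k ≤ K, x k ≤ x (k + 1)) {t : ℝ} (ht : t ∈ Icc (0 : ℝ) 1)
    (h : t = 0 ∨ t = 1 ∨ ∀ k ≤ K + 1, x k ≠ t) :
    ∃ k ≤ K, t ∈ Icc (x k) (x (k + 1)) ∧ chgSign K x t = (-1) ^ k := by
  classical
  have hnonneg : ∀ k ≤ K + 1, 0 ≤ x k := by
    intro k
    induction k with
    | zero => intro _; exact hx0.ge
    | succ k ih => intro hk; exact (ih (by omega)).trans (hmono k (by omega))
  have hle_one : ∀ j ≤ K + 1, x (K + 1 - j) ≤ 1 := by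
    intro j
    induction j with
    | zero => intro _; exact hxK.le
    | succ j ih =>
      intro hj
      have h1 := hmono (K + 1 - (j + 1)) (by omega)
      rw [show K + 1 - (j + 1) + 1 = K + 1 - j by omega] at h1
      exact h1.trans (ih (by omega))
  unfold chgSign
  by_cases hin : ∃ k, k ≤ K ∧ x k < t ∧ t < x (k + 1)
  · rw [dif_pos hin]
    obtain ⟨hk, hk1, hk2⟩ := Nat.find_spec hin
    exact ⟨_, hk, ⟨hk1.le, hk2.le⟩, rfl⟩
  rw [dif_neg hin]
  by_cases h0 : t = 0
  · subst h0
    have hex : ∃ k, k ≤ K ∧ (0 : ℝ) < x (k + 1) := ⟨K, le_rfl, by rw [hxK]; exact one_pos⟩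
    rw [if_pos rfl, dif_pos hex]
    obtain ⟨hk, hk1⟩ := Nat.find_spec hex
    refine ⟨_, hk, ⟨?_, hk1.le⟩, rfl⟩
    rcases hn : Nat.find hex with _ | n
    · exact hx0.le
    · have := Nat.find_min hex (m := n) (by omega)
      by_contra! hlt
      exact this ⟨by omega, hlt⟩
  rw [if_neg h0]
  by_cases h1 : t = 1
  · subst h1
    have hex : ∃ j, j ≤ K ∧ x (K - j) < 1 := ⟨K, le_rfl, by simp [hx0]⟩
    rw [if_pos rfl, dif_pos hex]
    obtain ⟨hk, hk1⟩ := Nat.find_spec hex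
    refine ⟨_, Nat.sub_le _ _, ⟨hk1.le, ?_⟩, rfl⟩
    rcases hn : Nat.find hex with _ | n
    · exact hxK.ge
    · have := Nat.find_min hex (m := n) (by omega)
      by_contra! hlt
      refine this ⟨by omega, ?_⟩
      rwa [show K - n = K - (n + 1) + 1 by omega]
  have hne : ∀ k ≤ K + 1, x k ≠ t := by tauto
  have hlt : ∀ k ≤ K + 1, x k < t := by
    intro k
    induction k with
    | zero => intro _; rw [hx0]; exact lt_of_le_of_ne ht.1 (Ne.symm h0)
    | succ k ih =>
      intro hk
      refine lt_of_le_of_ne ?_ (hne _ hk)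
      by_contra! hlt
      exact hin ⟨k, by omega, ih (by omega), hlt⟩
  exact absurd (hlt (K + 1) le_rfl) (by rw [hxK]; exact not_lt.2 ht.2)

open Set in
/-- The iterated derivatives of a `C^n` function on a closed interval form a chain of one-sided
derivatives. -/
theorem ContDiffOn.hasDerivWithinAt_iteratedDerivWithin_Icc {n i : ℕ} {f : ℝ → ℝ} {a b : ℝ}
    (hab : a < b) (hf : ContDiffOn ℝ n f (Icc a b)) (hi : i < n) {t : ℝ} (ht : t ∈ Icc a b) :
    HasDerivWithinAt (iteratedDerivWithin i f (Icc a b))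
      (iteratedDerivWithin (i + 1) f (Icc a b) t) (Icc a b) t := by
  rw [iteratedDerivWithin_succ]
  exact (hf.differentiableOn_iteratedDerivWithin (by exact_mod_cast hi)
    (uniqueDiffOn_Icc hab) t ht).hasDerivWithinAt

open Set in
/-- Repeated integration by parts, moving `q` derivatives from `f` to `g`. -/
theorem integral_iteratedDerivWithin_mul_eq_sum_add {a b : ℝ} (hab : a < b) {m n : ℕ}
    {f g : ℝ → ℝ} (hf : ContDiffOn ℝ m f (Icc a b)) (hg : ContDiffOn ℝ n g (Icc a b))
    (q : ℕ) (hqm : q ≤ m) (hqn : m + q ≤ n) :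
    ∫ t in a..b, iteratedDerivWithin m f (Icc a b) t * iteratedDerivWithin m g (Icc a b) t =
      (∑ i ∈ Finset.range q, (-1 : ℝ) ^ i *
        (iteratedDerivWithin (m - 1 - i) f (Icc a b) b * iteratedDerivWithin (m + i) g (Icc a b) b -
          iteratedDerivWithin (m - 1 - i) f (Icc a b) a *
            iteratedDerivWithin (m + i) g (Icc a b) a)) +
      (-1 : ℝ) ^ q * ∫ t in a..b,
        iteratedDerivWithin (m - q) f (Icc a b) t * iteratedDerivWithin (m + q) g (Icc a b) t := by
  induction q with
  | zero => simp
  | succ q ih =>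
    have hu := uniqueDiffOn_Icc hab
    rw [ih (by omega) (by omega), Finset.sum_range_succ]
    have hparts := intervalIntegral.integral_mul_deriv_eq_deriv_mul_of_hasDerivWithinAt
      (a := a) (b := b)
      (u := iteratedDerivWithin (m - (q + 1)) f (Icc a b))
      (v := iteratedDerivWithin (m + q) g (Icc a b))
      (u' := iteratedDerivWithin (m - (q + 1) + 1) f (Icc a b))
      (v' := iteratedDerivWithin (m + q + 1) g (Icc a b))
      (fun t ht => by
        rw [uIcc_of_le hab.le] at ht ⊢
        exact hf.hasDerivWithinAt_iteratedDerivWithin_Icc hab (by omega) ht)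
      (fun t ht => by
        rw [uIcc_of_le hab.le] at ht ⊢
        exact hg.hasDerivWithinAt_iteratedDerivWithin_Icc hab (by omega) ht)
    have hcf : ∀ i ≤ m, ContinuousOn (iteratedDerivWithin i f (Icc a b)) (uIcc a b) := by
      intro i hi
      rw [uIcc_of_le hab.le]
      exact hf.continuousOn_iteratedDerivWithin (by exact_mod_cast hi) hu
    have hcg : ∀ i ≤ n, ContinuousOn (iteratedDerivWithin i g (Icc a b)) (uIcc a b) := by
      intro i hi
      rw [uIcc_of_le hab.le]
      exact hg.continuousOn_iteratedDerivWithin (by exact_mod_cast hi) hu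
    have hparts := hparts (hcf _ (by omega)).intervalIntegrable
      (hcg _ (by omega)).intervalIntegrable
    rw [show m - (q + 1) + 1 = m - q by omega] at hparts
    rw [show m - 1 - q = m - (q + 1) by omega, show m + (q + 1) = m + q + 1 by omega, pow_succ]
    linear_combination (-1 : ℝ) ^ q * hparts

/-- Sufficient conditions for membership in the negative polar cone of
`V^{K,ℓ}[x]` (`0 ≤ ℓ < m`): if `g ∈ C^{2m-ℓ}[0,1]` satisfies the sign, boundary, and
endpoint conditions (a)–(f), then `⟪g,f⟫ ≤ 0` for every `f ∈ C^m[0,1]` with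
`(-1)^{k-1} f^(ℓ) ≥ 0` on `[x_{k-1}, x_k]` for all `k`. -/
theorem negative_polar_membership (m l K : ℕ) (hm : 1 ≤ m) (hl : l < m)
    (x : ℕ → ℝ) (hx0 : x 0 = 0) (hxK : x (K + 1) = 1)
    (hmono : ∀ k ≤ K, x k ≤ x (k + 1))
    (g : ℝ → ℝ) (hg : ContDiffOn ℝ (2 * m - l) g (Set.Icc 0 1))
    (hga : ∀ t ∈ Set.Icc (0 : ℝ) 1,
      (-1 : ℝ) ^ (m - l) * chgSign K x t *
        iteratedDerivWithin (2 * m - l) g (Set.Icc 0 1) t ≤ 0)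
    (hgb : ∀ j < l, iteratedDerivWithin j g (Set.Icc 0 1) 0 = 0)
    (hgc : ∀ j : ℕ, j + l + 2 ≤ m →
      iteratedDerivWithin (m - 1 - j) g (Set.Icc 0 1) 0 =
        (-1 : ℝ) ^ j * iteratedDerivWithin (m + j) g (Set.Icc 0 1) 0)
    (hgd : ∀ j : ℕ, j + l + 2 ≤ m → iteratedDerivWithin (m + j) g (Set.Icc 0 1) 1 = 0)
    (hge : 0 ≤ (-1 : ℝ) ^ (m - l) * chgSign K x 1 *
      iteratedDerivWithin (2 * m - l - 1) g (Set.Icc 0 1) 1)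
    (hgf : chgSign K x 0 *
      (iteratedDerivWithin l g (Set.Icc 0 1) 0 +
        (-1 : ℝ) ^ (m - l) * iteratedDerivWithin (2 * m - l - 1) g (Set.Icc 0 1) 0) ≤ 0) :
    ∀ f : ℝ → ℝ, ContDiffOn ℝ m f (Set.Icc 0 1) →
      (∀ k ≤ K, ∀ t ∈ Set.Icc (x k) (x (k + 1)),
        0 ≤ (-1 : ℝ) ^ k * iteratedDerivWithin l f (Set.Icc 0 1) t) →
      dualPairing m g f ≤ 0 := by
  intro f hf hfl
  obtain ⟨q, rfl⟩ : ∃ q, m = l + q + 1 := ⟨m - l - 1, by omega⟩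
  replace hg : ContDiffOn ℝ ((l + 2 * q + 2 : ℕ) : WithTop ℕ∞) g (Set.Icc 0 1) := by
    refine hg.of_le ?_
    rw [show (2 : WithTop ℕ∞) * ((l + q + 1 : ℕ) : WithTop ℕ∞) - (l : WithTop ℕ∞)
      = ((2 * (l + q + 1) - l : ℕ) : WithTop ℕ∞) by norm_cast]
    exact_mod_cast (by omega : l + 2 * q + 2 ≤ 2 * (l + q + 1) - l)
  rw [show l + q + 1 - l = q + 1 by omega] at hga hge hgf
  rw [show 2 * (l + q + 1) - l - 1 = l + 2 * q + 1 by omega] at hge hgf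
  rw [show 2 * (l + q + 1) - l = l + 2 * q + 2 by omega] at hga
  have hsign : ∀ t ∈ Set.Icc (0 : ℝ) 1, (t = 0 ∨ t = 1 ∨ ∀ k ≤ K + 1, x k ≠ t) →
      chgSign K x t * chgSign K x t = 1 ∧
        0 ≤ chgSign K x t * iteratedDerivWithin l f (Set.Icc 0 1) t := by
    intro t ht h
    obtain ⟨k, hk, htk, hχ⟩ := exists_chgSign_eq_neg_one_pow hx0 hxK hmono ht h
    rw [hχ]
    exact ⟨by rw [← mul_pow]; norm_num, hfl k hk t htk⟩
  have hint : (-1 : ℝ) ^ (q + 1) * ∫ t in (0 : ℝ)..1, iteratedDerivWithin l f (Set.Icc 0 1) t *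
      iteratedDerivWithin (l + 2 * q + 2) g (Set.Icc 0 1) t ≤ 0 := by
    rw [← intervalIntegral.integral_const_mul]
    have hfin : (x '' Set.Iic (K + 1)).Finite := (Set.finite_Iic _).image x
    have hae : ∀ᵐ t ∂(MeasureTheory.volume : MeasureTheory.Measure ℝ),
        t ∉ x '' Set.Iic (K + 1) := hfin.countable.ae_notMem _
    rw [intervalIntegral.integral_of_le zero_le_one]
    refine MeasureTheory.integral_nonpos_of_ae ?_
    filter_upwards [MeasureTheory.ae_restrict_of_ae hae,
      MeasureTheory.ae_restrict_mem measurableSet_Ioc] with t hne ht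
    have htI := Set.Ioc_subset_Icc_self ht
    obtain ⟨hsq, hpos⟩ := hsign t htI (Or.inr (Or.inr fun k hk h => hne ⟨k, hk, h⟩))
    have key := mul_nonpos_of_nonneg_of_nonpos hpos (hga t htI)
    calc _ = (chgSign K x t * chgSign K x t) * ((-1 : ℝ) ^ (q + 1) *
          (iteratedDerivWithin l f (Set.Icc 0 1) t *
            iteratedDerivWithin (l + 2 * q + 2) g (Set.Icc 0 1) t)) := by rw [hsq, one_mul]
      _ ≤ 0 := by linarith
  have hone : 0 ≤ (-1 : ℝ) ^ (q + 1) * (iteratedDerivWithin l f (Set.Icc 0 1) 1 *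
      iteratedDerivWithin (l + 2 * q + 1) g (Set.Icc 0 1) 1) := by
    obtain ⟨hsq, hpos⟩ := hsign 1 (by simp) (by simp)
    have key := mul_nonneg hpos hge
    linear_combination key + ((-1 : ℝ) ^ (q + 1) * (iteratedDerivWithin l f (Set.Icc 0 1) 1 *
      iteratedDerivWithin (l + 2 * q + 1) g (Set.Icc 0 1) 1)) * hsq
  have hzero : iteratedDerivWithin l f (Set.Icc 0 1) 0 * (iteratedDerivWithin l g (Set.Icc 0 1) 0 +
      (-1 : ℝ) ^ (q + 1) * iteratedDerivWithin (l + 2 * q + 1) g (Set.Icc 0 1) 0) ≤ 0 := by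
    obtain ⟨hsq, hpos⟩ := hsign 0 (by simp) (by simp)
    have key := mul_nonpos_of_nonneg_of_nonpos hpos hgf
    linear_combination key - (iteratedDerivWithin l f (Set.Icc 0 1) 0 *
      (iteratedDerivWithin l g (Set.Icc 0 1) 0 +
        (-1 : ℝ) ^ (q + 1) * iteratedDerivWithin (l + 2 * q + 1) g (Set.Icc 0 1) 0)) * hsq
  have hsum : ∑ j ∈ Finset.range (l + q + 1),
      iteratedDerivWithin j g (Set.Icc 0 1) 0 * iteratedDerivWithin j f (Set.Icc 0 1) 0 =
      (∑ i ∈ Finset.range q, (-1 : ℝ) ^ i * (iteratedDerivWithin (l + q + 1 - 1 - i) f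
        (Set.Icc 0 1) 0 * iteratedDerivWithin (l + q + 1 + i) g (Set.Icc 0 1) 0)) +
      iteratedDerivWithin l g (Set.Icc 0 1) 0 * iteratedDerivWithin l f (Set.Icc 0 1) 0 := by
    rw [← Finset.sum_range_reflect,
      ← Finset.sum_subset (Finset.range_mono (by omega : q + 1 ≤ l + q + 1)), Finset.sum_range_succ,
      show l + q + 1 - 1 - q = l by omega]
    · congr 1
      refine Finset.sum_congr rfl fun i hi => ?_
      rw [hgc i (by have := Finset.mem_range.1 hi; omega)]
      ring
    · intro j hj hj'
      rw [Finset.mem_range] at hj hj'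
      rw [hgb _ (by omega), zero_mul]
  have hparts := integral_iteratedDerivWithin_mul_eq_sum_add zero_lt_one hf hg (q + 1)
    (by omega) (by omega)
  have hboundary : ∑ i ∈ Finset.range q, (-1 : ℝ) ^ i *
      (iteratedDerivWithin (l + q + 1 - 1 - i) f (Set.Icc 0 1) 1 *
          iteratedDerivWithin (l + q + 1 + i) g (Set.Icc 0 1) 1 -
        iteratedDerivWithin (l + q + 1 - 1 - i) f (Set.Icc 0 1) 0 *
          iteratedDerivWithin (l + q + 1 + i) g (Set.Icc 0 1) 0) =
      -∑ i ∈ Finset.range q, (-1 : ℝ) ^ i * (iteratedDerivWithin (l + q + 1 - 1 - i) f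
        (Set.Icc 0 1) 0 * iteratedDerivWithin (l + q + 1 + i) g (Set.Icc 0 1) 0) := by
    rw [← Finset.sum_neg_distrib]
    refine Finset.sum_congr rfl fun i hi => ?_
    rw [hgd i (by have := Finset.mem_range.1 hi; omega)]
    ring
  rw [Finset.sum_range_succ, hboundary, show l + q + 1 - 1 - q = l by omega,
    show l + q + 1 + q = l + 2 * q + 1 by omega, show l + q + 1 - (q + 1) = l by omega,
    show l + q + 1 + (q + 1) = l + 2 * q + 2 by omega] at hparts
  rw [dualPairing, hsum, hparts]
  rw [pow_succ] at hint hone hzero ⊢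
  linarith
end

section
/- Let m ≥ 1, 1 < p < ∞, λ > 0, let h₁,…,h_N be continuous functions on [0,1] that separate polynomials of degree m−1, let y ∈ ℝ^N, and let ρ₁,…,ρ_N : ℝ → ℝ be strictly convex. Then the penalized likelihood J(a,u) = (λ/p)∫₀¹|u(s)|^p ds + Σ_{i=1}^N ρ_i(∫₀¹ h_i(t) f_{a,u}(t) dt − y_i) is strictly convex on ℝ^m × L^p([0,1]): for all (a,u) and (a′,u′) with a ≠ a′ or u ≠ u′ in L^p, and all θ ∈ (0,1), J(θ(a,u) + (1−θ)(a′,u′)) < θJ(a,u) + (1−θ)J(a′,u′). -/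
open MeasureTheory

/-- The Sobolev function represented by the pair `(a, u) ∈ ℝ^m × L^p`:
`f_{a,u}(t) = ∑_{j<m} a_j t^j/j! + ∫₀ᵗ ((t-s)^{m-1}/(m-1)!) u(s) ds`. -/
noncomputable def fAU (m : ℕ) (a : Fin m → ℝ) (u : ℝ → ℝ) (t : ℝ) : ℝ :=
  (∑ j : Fin m, a j * t ^ (j : ℕ) / (Nat.factorial (j : ℕ) : ℝ))
    + ∫ s in (0 : ℝ)..t, ((t - s) ^ (m - 1) / (Nat.factorial (m - 1) : ℝ)) * u s

theorem strictConvexOn_abs_rpow {p : ℝ} (hp : 1 < p) :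
    StrictConvexOn ℝ Set.univ fun x : ℝ => |x| ^ p := by
  refine ⟨convex_univ, fun x _ y _ hxy a b ha hb hab => ?_⟩
  simp only [smul_eq_mul]
  have htri : |a * x + b * y| ≤ a * |x| + b * |y| := by
    calc |a * x + b * y| ≤ |a * x| + |b * y| := abs_add_le _ _
      _ = a * |x| + b * |y| := by rw [abs_mul, abs_mul, abs_of_pos ha, abs_of_pos hb]
  by_cases hne : |x| = |y|
  · have hxy' : x = -y := (abs_eq_abs.mp hne).resolve_left hxy
    have hy : 0 < |y| := by
      refine abs_pos.mpr fun hy => hxy ?_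
      simp [hxy', hy]
    have hlt : |a * x + b * y| < |y| := by
      have : a * x + b * y = (b - a) * y := by rw [hxy']; ring
      rw [this, abs_mul]
      have : |b - a| < 1 := abs_lt.mpr ⟨by linarith, by linarith⟩
      nlinarith
    calc |a * x + b * y| ^ p < |y| ^ p := Real.rpow_lt_rpow (abs_nonneg _) hlt (by linarith)
      _ = a * |x| ^ p + b * |y| ^ p := by rw [hne, ← add_mul, hab, one_mul]
  · calc |a * x + b * y| ^ p ≤ (a * |x| + b * |y|) ^ p :=
          Real.rpow_le_rpow (abs_nonneg _) htri (by linarith)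
      _ < a * |x| ^ p + b * |y| ^ p := by
          simpa using (strictConvexOn_rpow hp).2 (abs_nonneg x) (abs_nonneg y) hne ha hb hab

theorem integrable_abs_rpow_of_memLp {α : Type*} [MeasurableSpace α] {μ : Measure α} {p : ℝ}
    (hp : 0 < p) {u : α → ℝ} (hu : MemLp u (ENNReal.ofReal p) μ) :
    Integrable (fun x => |u x| ^ p) μ := by
  have := hu.integrable_norm_rpow (by simpa using hp) ENNReal.ofReal_ne_top
  simpa [ENNReal.toReal_ofReal hp.le] using this

theorem integral_abs_rpow_combo_le {α : Type*} [MeasurableSpace α] {μ : Measure α} {p : ℝ}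
    (hp : 1 < p) {u v : α → ℝ} (hu : MemLp u (ENNReal.ofReal p) μ)
    (hv : MemLp v (ENNReal.ofReal p) μ) {a b : ℝ} (ha : 0 < a) (hb : 0 < b) (hab : a + b = 1) :
    ∫ x, |a * u x + b * v x| ^ p ∂μ ≤ a * ∫ x, |u x| ^ p ∂μ + b * ∫ x, |v x| ^ p ∂μ := by
  have hp0 : 0 < p := by linarith
  have iu := integrable_abs_rpow_of_memLp hp0 hu
  have iv := integrable_abs_rpow_of_memLp hp0 hv
  have iw := integrable_abs_rpow_of_memLp hp0 ((hu.const_mul a).add (hv.const_mul b))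
  rw [← integral_const_mul, ← integral_const_mul,
    ← integral_add (iu.const_mul a) (iv.const_mul b)]
  refine integral_mono iw ((iu.const_mul a).add (iv.const_mul b)) fun x => ?_
  simpa using (strictConvexOn_abs_rpow hp).convexOn.2 (Set.mem_univ (u x)) (Set.mem_univ (v x))
    ha.le hb.le hab

theorem integral_abs_rpow_combo_lt {α : Type*} [MeasurableSpace α] {μ : Measure α} {p : ℝ}
    (hp : 1 < p) {u v : α → ℝ} (hu : MemLp u (ENNReal.ofReal p) μ)
    (hv : MemLp v (ENNReal.ofReal p) μ) (huv : ¬ u =ᵐ[μ] v)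
    {a b : ℝ} (ha : 0 < a) (hb : 0 < b) (hab : a + b = 1) :
    ∫ x, |a * u x + b * v x| ^ p ∂μ < a * ∫ x, |u x| ^ p ∂μ + b * ∫ x, |v x| ^ p ∂μ := by
  have hp0 : 0 < p := by linarith
  refine lt_of_le_of_ne (integral_abs_rpow_combo_le hp hu hv ha hb hab) fun heq => huv ?_
  have iu := integrable_abs_rpow_of_memLp hp0 hu
  have iv := integrable_abs_rpow_of_memLp hp0 hv
  have iw : Integrable (fun x => |a * u x + b * v x| ^ p) μ :=
    integrable_abs_rpow_of_memLp hp0 ((hu.const_mul a).add (hv.const_mul b))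
  have iuv := (iu.const_mul a).add (iv.const_mul b)
  rw [← integral_const_mul, ← integral_const_mul,
    ← integral_add (iu.const_mul a) (iv.const_mul b)] at heq
  have hle : (fun x => |a * u x + b * v x| ^ p) ≤ᵐ[μ] fun x => a * |u x| ^ p + b * |v x| ^ p :=
    .of_forall fun x => by
      simpa using (strictConvexOn_abs_rpow hp).convexOn.2 (Set.mem_univ (u x))
        (Set.mem_univ (v x)) ha.le hb.le hab
  filter_upwards [(integral_eq_iff_of_ae_le iw iuv hle).mp heq] with x hx
  by_contra hne
  have := (strictConvexOn_abs_rpow hp).2 (Set.mem_univ (u x)) (Set.mem_univ (v x)) hne ha hb hab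
  simp only [smul_eq_mul] at this
  exact this.ne hx

theorem continuousOn_integral_pow_mul (k : ℕ) {u : ℝ → ℝ}
    (hu : IntegrableOn u (Set.Icc 0 1)) :
    ContinuousOn (fun t => ∫ s in (0 : ℝ)..t, (t - s) ^ k * u s) (Set.Icc 0 1) := by
  have hmom : ∀ j : ℕ, IntegrableOn (fun s => (-s) ^ j * u s) (Set.Icc 0 1) := fun j =>
    hu.continuousOn_mul (by fun_prop) isCompact_Icc
  have hexp : Set.EqOn (fun t => ∫ s in (0 : ℝ)..t, (t - s) ^ k * u s)
      (fun t => ∑ j ∈ Finset.range (k + 1),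
        (t ^ j * (k.choose j : ℝ)) * ∫ s in (0 : ℝ)..t, (-s) ^ (k - j) * u s) (Set.Icc 0 1) := by
    intro t ht
    have hint : ∀ j : ℕ, IntervalIntegrable (fun s => (-s) ^ j * u s) volume 0 t := fun j =>
      (intervalIntegrable_iff_integrableOn_Icc_of_le ht.1).mpr
        ((hmom j).mono_set (Set.Icc_subset_Icc_right ht.2))
    dsimp only
    simp_rw [← intervalIntegral.integral_const_mul]
    rw [← intervalIntegral.integral_finsetSum fun j _ => (hint _).const_mul _]
    refine intervalIntegral.integral_congr fun s _ => ?_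
    rw [sub_eq_add_neg, add_pow, Finset.sum_mul]
    exact Finset.sum_congr rfl fun j _ => by ring
  refine ContinuousOn.congr (continuousOn_finsetSum _ fun j _ => ?_) hexp
  refine ContinuousOn.mul (by fun_prop) ?_
  have := intervalIntegral.continuousOn_primitive_interval (μ := volume) (a := (0 : ℝ)) (b := 1)
    (f := fun s => (-s) ^ (k - j) * u s) (by simpa using hmom (k - j))
  simpa using this

theorem intervalIntegrable_kernel_mul (k : ℕ) {u : ℝ → ℝ}
    (hu : IntegrableOn u (Set.Icc 0 1)) {t : ℝ} (ht : t ∈ Set.Icc (0 : ℝ) 1) :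
    IntervalIntegrable (fun s => (t - s) ^ k / (Nat.factorial k : ℝ) * u s) volume 0 t :=
  (intervalIntegrable_iff_integrableOn_Icc_of_le ht.1).mpr
    ((hu.continuousOn_mul (by fun_prop) isCompact_Icc).mono_set (Set.Icc_subset_Icc_right ht.2))

theorem continuousOn_fAU (m : ℕ) (a : Fin m → ℝ) {u : ℝ → ℝ}
    (hu : IntegrableOn u (Set.Icc 0 1)) : ContinuousOn (fAU m a u) (Set.Icc 0 1) := by
  unfold fAU
  refine ContinuousOn.add (by fun_prop) ?_
  have := (continuousOn_integral_pow_mul (m - 1) hu).div_const (Nat.factorial (m - 1) : ℝ)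
  refine this.congr fun t _ => ?_
  dsimp only
  rw [← intervalIntegral.integral_div]
  exact intervalIntegral.integral_congr fun s _ => by ring

theorem fAU_combo (m : ℕ) (a a' : Fin m → ℝ) {u u' v : ℝ → ℝ}
    (hu : IntegrableOn u (Set.Icc 0 1)) (hu' : IntegrableOn u' (Set.Icc 0 1)) (c d : ℝ)
    (hv : v =ᵐ[volume.restrict (Set.Icc 0 1)] fun s => c * u s + d * u' s)
    {t : ℝ} (ht : t ∈ Set.Icc (0 : ℝ) 1) :
    fAU m (c • a + d • a') v t = c * fAU m a u t + d * fAU m a' u' t := by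
  have hI : (∫ s in (0 : ℝ)..t, ((t - s) ^ (m - 1) / (Nat.factorial (m - 1) : ℝ)) * v s)
      = c * (∫ s in (0 : ℝ)..t, ((t - s) ^ (m - 1) / (Nat.factorial (m - 1) : ℝ)) * u s)
        + d * ∫ s in (0 : ℝ)..t, ((t - s) ^ (m - 1) / (Nat.factorial (m - 1) : ℝ)) * u' s := by
    rw [← intervalIntegral.integral_const_mul, ← intervalIntegral.integral_const_mul,
      ← intervalIntegral.integral_add
        ((intervalIntegrable_kernel_mul (m - 1) hu ht).const_mul c)
        ((intervalIntegrable_kernel_mul (m - 1) hu' ht).const_mul d)]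
    refine intervalIntegral.integral_congr_ae ?_
    rw [Filter.EventuallyEq, ae_restrict_iff' measurableSet_Icc] at hv
    filter_upwards [hv] with s hs hst
    rw [Set.uIoc_of_le ht.1] at hst
    rw [hs ⟨hst.1.le, hst.2.trans ht.2⟩]
    ring
  unfold fAU
  rw [hI, mul_add, mul_add, Finset.mul_sum, Finset.mul_sum]
  have hS : ∑ j : Fin m, (c • a + d • a') j * t ^ (j : ℕ) / (Nat.factorial (j : ℕ) : ℝ)
      = ∑ j : Fin m, c * (a j * t ^ (j : ℕ) / (Nat.factorial (j : ℕ) : ℝ))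
        + ∑ j : Fin m, d * (a' j * t ^ (j : ℕ) / (Nat.factorial (j : ℕ) : ℝ)) := by
    rw [← Finset.sum_add_distrib]
    refine Finset.sum_congr rfl fun j _ => ?_
    simp only [Pi.add_apply, Pi.smul_apply, smul_eq_mul]
    ring
  rw [hS]
  ring

theorem integrableOn_mul_fAU (m : ℕ) {h : ℝ → ℝ} (hh : ContinuousOn h (Set.Icc 0 1))
    (a : Fin m → ℝ) {u : ℝ → ℝ} (hu : IntegrableOn u (Set.Icc 0 1)) :
    IntegrableOn (fun t => h t * fAU m a u t) (Set.Icc 0 1) :=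
  (hh.mul (continuousOn_fAU m a hu)).integrableOn_Icc

theorem integral_mul_fAU_combo (m : ℕ) {h : ℝ → ℝ} (hh : ContinuousOn h (Set.Icc 0 1))
    (a a' : Fin m → ℝ) {u u' v : ℝ → ℝ}
    (hu : IntegrableOn u (Set.Icc 0 1)) (hu' : IntegrableOn u' (Set.Icc 0 1)) (c d : ℝ)
    (hv : v =ᵐ[volume.restrict (Set.Icc 0 1)] fun s => c * u s + d * u' s) :
    ∫ t in Set.Icc (0 : ℝ) 1, h t * fAU m (c • a + d • a') v t
      = c * (∫ t in Set.Icc (0 : ℝ) 1, h t * fAU m a u t)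
        + d * ∫ t in Set.Icc (0 : ℝ) 1, h t * fAU m a' u' t := by
  rw [← integral_const_mul, ← integral_const_mul,
    ← integral_add ((integrableOn_mul_fAU m hh a hu).const_mul c)
      ((integrableOn_mul_fAU m hh a' hu').const_mul d)]
  refine setIntegral_congr_fun measurableSet_Icc fun t ht => ?_
  rw [fAU_combo m a a' hu hu' c d hv ht]
  ring

theorem eq_of_integral_mul_fAU_eq {m N : ℕ} {h : Fin N → ℝ → ℝ}
    (hcont : ∀ i, ContinuousOn (h i) (Set.Icc 0 1))
    (hsep : ∀ b : Fin m → ℝ,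
      (∀ i, ∫ t in Set.Icc (0 : ℝ) 1, h i t * (∑ j : Fin m, b j * t ^ (j : ℕ)) = 0) → b = 0)
    {a a' : Fin m → ℝ} {u : ℝ → ℝ} (hu : IntegrableOn u (Set.Icc 0 1))
    (heq : ∀ i, ∫ t in Set.Icc (0 : ℝ) 1, h i t * fAU m a u t
      = ∫ t in Set.Icc (0 : ℝ) 1, h i t * fAU m a' u t) : a = a' := by
  have hb := hsep (fun j => (a j - a' j) / (Nat.factorial (j : ℕ) : ℝ)) fun i => by
    have hsub := integral_sub (integrableOn_mul_fAU m (hcont i) a hu)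
      (integrableOn_mul_fAU m (hcont i) a' hu)
    rw [heq i, sub_self] at hsub
    refine Eq.trans ?_ hsub
    refine setIntegral_congr_fun measurableSet_Icc fun t _ => ?_
    simp only [fAU]
    rw [← mul_sub, add_sub_add_right_eq_sub, ← Finset.sum_sub_distrib]
    congr 1
    exact Finset.sum_congr rfl fun j _ => by ring
  funext j
  have hj := congrFun hb j
  simpa [sub_eq_zero, Nat.factorial_ne_zero] using hj

/-- The penalized likelihood
`J(a,u) = (λ/p)∫₀¹|u|^p + ∑ᵢ ρᵢ(∫₀¹ hᵢ f_{a,u} - yᵢ)` is strictly convex on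
`ℝ^m × L^p([0,1])` when the `hᵢ` separate polynomials of degree `m-1` and the `ρᵢ` are
strictly convex. -/
theorem penalized_likelihood_strictly_convex (m : ℕ) (hm : 1 ≤ m)
    (p : ℝ) (hp : 1 < p) (lam : ℝ) (hlam : 0 < lam)
    (N : ℕ) (h : Fin N → ℝ → ℝ) (hcont : ∀ i, ContinuousOn (h i) (Set.Icc 0 1))
    (hsep : ∀ b : Fin m → ℝ,
      (∀ i, ∫ t in Set.Icc (0 : ℝ) 1, h i t * (∑ j : Fin m, b j * t ^ (j : ℕ)) = 0) → b = 0)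
    (y : Fin N → ℝ) (ρ : Fin N → ℝ → ℝ)
    (hρ : ∀ i, StrictConvexOn ℝ Set.univ (ρ i))
    [Fact (1 ≤ ENNReal.ofReal p)] :
    let μ := volume.restrict (Set.Icc (0 : ℝ) 1)
    let J : (Fin m → ℝ) × Lp ℝ (ENNReal.ofReal p) μ → ℝ := fun z =>
      (lam / p) * (∫ s in Set.Icc (0 : ℝ) 1, |(z.2 : ℝ → ℝ) s| ^ p)
        + ∑ i, ρ i ((∫ t in Set.Icc (0 : ℝ) 1, h i t * fAU m z.1 (z.2 : ℝ → ℝ) t) - y i)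
    ∀ z z' : (Fin m → ℝ) × Lp ℝ (ENNReal.ofReal p) μ, z ≠ z' →
      ∀ θ : ℝ, 0 < θ → θ < 1 →
        J (θ • z + (1 - θ) • z') < θ * J z + (1 - θ) * J z' := by
  intro μ J z z' hzz θ hθ0 hθ1
  have hθ1' : 0 < 1 - θ := by linarith
  have hsum : θ + (1 - θ) = 1 := by ring
  have hv : (((θ • z + (1 - θ) • z').2 : Lp ℝ (ENNReal.ofReal p) μ) : ℝ → ℝ)
      =ᵐ[μ] fun s => θ * z.2 s + (1 - θ) * z'.2 s := by
    filter_upwards [Lp.coeFn_add (θ • z.2) ((1 - θ) • z'.2), Lp.coeFn_smul θ z.2,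
      Lp.coeFn_smul (1 - θ) z'.2] with s h₁ h₂ h₃
    simpa [h₂, h₃] using h₁
  have hz := Lp.memLp z.2
  have hz' := Lp.memLp z'.2
  have iz : IntegrableOn z.2 (Set.Icc 0 1) := hz.integrable Fact.out
  have iz' : IntegrableOn z'.2 (Set.Icc 0 1) := hz'.integrable Fact.out
  have hpen : ∫ s in Set.Icc (0 : ℝ) 1, |(θ • z + (1 - θ) • z').2 s| ^ p
      = ∫ s in Set.Icc (0 : ℝ) 1, |θ * z.2 s + (1 - θ) * z'.2 s| ^ p :=
    integral_congr_ae (hv.mono fun s hs => by dsimp only; rw [hs])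
  let L : Fin N → ((Fin m → ℝ) × Lp ℝ (ENNReal.ofReal p) μ) → ℝ := fun i w =>
    ∫ t in Set.Icc (0 : ℝ) 1, h i t * fAU m w.1 w.2 t
  have hL : ∀ i, L i (θ • z + (1 - θ) • z') - y i
      = θ • (L i z - y i) + (1 - θ) • (L i z' - y i) := fun i => by
    have : L i (θ • z + (1 - θ) • z') = θ * L i z + (1 - θ) * L i z' :=
      integral_mul_fAU_combo m (hcont i) z.1 z'.1 iz iz' θ (1 - θ) hv
    rw [this, smul_eq_mul, smul_eq_mul]
    ring
  have hfit : ∀ i, ρ i (L i (θ • z + (1 - θ) • z') - y i)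
      ≤ θ * ρ i (L i z - y i) + (1 - θ) * ρ i (L i z' - y i) := fun i => by
    rw [hL i]
    exact (hρ i).convexOn.2 (Set.mem_univ _) (Set.mem_univ _) hθ0.le hθ1'.le hsum
  have hJ : ∀ w, J w = (lam / p) * (∫ s in Set.Icc (0 : ℝ) 1, |w.2 s| ^ p)
      + ∑ i, ρ i (L i w - y i) := fun _ => rfl
  have hlp : 0 < lam / p := by positivity
  have hrhs : θ * J z + (1 - θ) * J z'
      = (lam / p) * (θ * (∫ s in Set.Icc (0 : ℝ) 1, |z.2 s| ^ p)
          + (1 - θ) * ∫ s in Set.Icc (0 : ℝ) 1, |z'.2 s| ^ p)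
        + ∑ i, (θ * ρ i (L i z - y i) + (1 - θ) * ρ i (L i z' - y i)) := by
    rw [hJ, hJ, Finset.sum_add_distrib, ← Finset.mul_sum, ← Finset.mul_sum]
    ring
  rw [hrhs, hJ, hpen]
  by_cases hu : z.2 = z'.2
  · have ha : z.1 ≠ z'.1 := fun ha => hzz (Prod.ext ha hu)
    obtain ⟨i, hi⟩ : ∃ i, L i z ≠ L i z' := by
      by_contra! hall
      refine ha (eq_of_integral_mul_fAU_eq hcont hsep iz fun i => ?_)
      have := hall i
      simp only [L, ← hu] at this
      exact this
    refine add_lt_add_of_le_of_lt (mul_le_mul_of_nonneg_left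
      (integral_abs_rpow_combo_le hp hz hz' hθ0 hθ1' hsum) hlp.le) ?_
    refine Finset.sum_lt_sum (fun i _ => hfit i) ⟨i, Finset.mem_univ i, ?_⟩
    rw [hL i]
    exact (hρ i).2 (Set.mem_univ _) (Set.mem_univ _) (fun hc => hi (sub_left_injective hc))
      hθ0 hθ1' hsum
  · refine add_lt_add_of_lt_of_le (mul_lt_mul_of_pos_left
      (integral_abs_rpow_combo_lt hp hz hz' (fun hc => hu (Lp.ext hc)) hθ0 hθ1' hsum) hlp)
      (Finset.sum_le_sum fun i _ => hfit i)
end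

section
/- Let m ≥ 1, 0 ≤ ℓ ≤ m, 1 < p < ∞, λ > 0, K ≥ 0, and fix change points 0 = x₀ ≤ x₁ ≤ … ≤ x_K ≤ x_{K+1} = 1. Let h₁,…,h_N be continuous functions on [0,1] that separate polynomials of degree m−1, let y ∈ ℝ^N, and let each ρ_i : ℝ → ℝ be strictly convex, continuous, and coercive (ρ_i(x) → ∞ as |x| → ∞). Then the penalized likelihood J(a,u) = (λ/p)∫₀¹|u(s)|^p ds + Σ_{i=1}^N ρ_i(∫₀¹ h_i(t) f_{a,u}(t) dt − y_i) attains its infimum over the constraint cone V^{K,ℓ}[x] ⊆ ℝ^m × L^p([0,1]) at a unique minimizer. -/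
open MeasureTheory

/-- The `ℓ`-th derivative of the Sobolev function represented by the pair `(a, u)`:
`f_{a,u}^(ℓ)(t) = ∑_{ℓ ≤ j < m} a_j t^{j-ℓ}/(j-ℓ)! + ∫₀ᵗ ((t-s)^{m-ℓ-1}/(m-ℓ-1)!) u(s) ds`. -/
noncomputable def fAUDeriv (m l : ℕ) (a : Fin m → ℝ) (u : ℝ → ℝ) (t : ℝ) : ℝ :=
  (∑ j : Fin m, if l ≤ (j : ℕ) then
      a j * t ^ ((j : ℕ) - l) / (Nat.factorial ((j : ℕ) - l) : ℝ) else 0)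
    + ∫ s in (0 : ℝ)..t,
        ((t - s) ^ (m - l - 1) / (Nat.factorial (m - l - 1) : ℝ)) * u s

section Pointwise

variable {p : ℝ}

lemma abs_midpoint_rpow_lt (hp : 1 < p) {a b : ℝ} (hab : a ≠ b) :
    |(a + b) / 2| ^ p < (|a| ^ p + |b| ^ p) / 2 := by
  have hp0 : 0 < p := by linarith
  by_cases h : |a| = |b|
  · rcases abs_eq_abs.mp h with h' | h'
    · exact absurd h' hab
    · subst h'
      have hb : b ≠ 0 := by rintro rfl; simp at hab
      have : 0 < |b| ^ p := Real.rpow_pos_of_pos (abs_pos.mpr hb) p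
      simp only [neg_add_cancel, zero_div, abs_zero, Real.zero_rpow hp0.ne', abs_neg]
      linarith
  · have h1 := (strictConvexOn_rpow hp).2 (Set.mem_Ici.mpr (abs_nonneg a))
      (Set.mem_Ici.mpr (abs_nonneg b)) h
      (by norm_num : (0 : ℝ) < 1 / 2) (by norm_num : (0 : ℝ) < 1 / 2) (by norm_num)
    simp only [smul_eq_mul] at h1
    have h2 : |(a + b) / 2| ^ p ≤ (1 / 2 * |a| + 1 / 2 * |b|) ^ p := by
      refine Real.rpow_le_rpow (abs_nonneg _) ?_ hp0.le
      rw [abs_div, abs_two]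
      linarith [abs_add_le a b]
    linarith

lemma abs_midpoint_rpow_le (hp : 1 < p) (a b : ℝ) :
    |(a + b) / 2| ^ p ≤ (|a| ^ p + |b| ^ p) / 2 := by
  rcases eq_or_ne a b with rfl | h
  · simp
  · exact (abs_midpoint_rpow_lt hp h).le

/-- Quantitative strict convexity of `|·| ^ p`, up to an arbitrarily small error. -/
lemma exists_abs_sub_rpow_le (hp : 1 < p) {ε : ℝ} (hε : 0 < ε) :
    ∃ C, 0 ≤ C ∧ ∀ a b : ℝ, |a - b| ^ p ≤ ε * (|a| ^ p + |b| ^ p) +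
      C * ((|a| ^ p + |b| ^ p) / 2 - |(a + b) / 2| ^ p) := by
  have hp0 : 0 < p := by linarith
  let S : Set (ℝ × ℝ) := {z | |z.1| ^ p + |z.2| ^ p = 1 ∧ ε ≤ |z.1 - z.2| ^ p}
  have hle : ∀ z : ℝ × ℝ, |z.1| ^ p + |z.2| ^ p = 1 → |z.1| ≤ 1 ∧ |z.2| ≤ 1 := by
    intro z hz
    have h1 : 0 ≤ |z.1| ^ p := by positivity
    have h2 : 0 ≤ |z.2| ^ p := by positivity
    constructor <;> by_contra! hlt
    · linarith [Real.one_lt_rpow hlt hp0]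
    · linarith [Real.one_lt_rpow hlt hp0]
  have hS : IsCompact S := by
    refine (isCompact_closedBall (0 : ℝ × ℝ) 1).of_isClosed_subset ?_ ?_
    · refine (isClosed_eq ?_ continuous_const).and (isClosed_le continuous_const ?_)
      · exact (continuous_fst.abs.rpow_const fun _ => Or.inr hp0.le).add
          (continuous_snd.abs.rpow_const fun _ => Or.inr hp0.le)
      · exact (continuous_fst.sub continuous_snd).abs.rpow_const fun _ => Or.inr hp0.le
    · intro z hz
      simpa [Prod.norm_def] using hle z hz.1
  let d : ℝ × ℝ → ℝ := fun z => (|z.1| ^ p + |z.2| ^ p) / 2 - |(z.1 + z.2) / 2| ^ p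
  have hd : Continuous d :=
    (((continuous_fst.abs.rpow_const fun _ => Or.inr hp0.le).add
      (continuous_snd.abs.rpow_const fun _ => Or.inr hp0.le)).div_const 2).sub
      (((continuous_fst.add continuous_snd).div_const 2).abs.rpow_const fun _ => Or.inr hp0.le)
  have hd0 : ∀ z, 0 ≤ d z := fun z => sub_nonneg.mpr (abs_midpoint_rpow_le hp z.1 z.2)
  obtain ⟨δ, hδ, hδS⟩ : ∃ δ > 0, ∀ z ∈ S, δ ≤ d z := by
    rcases S.eq_empty_or_nonempty with he | hne
    · exact ⟨1, one_pos, by simp [he]⟩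
    · obtain ⟨z, hz, hmin⟩ := hS.exists_isMinOn hne hd.continuousOn
      refine ⟨d z, ?_, fun w hw => hmin hw⟩
      refine sub_pos.mpr (abs_midpoint_rpow_lt hp fun h => ?_)
      have := hz.2
      rw [h, sub_self, abs_zero, Real.zero_rpow hp0.ne'] at this
      linarith
  have hunit : ∀ z : ℝ × ℝ, |z.1| ^ p + |z.2| ^ p = 1 →
      |z.1 - z.2| ^ p ≤ ε + 2 ^ p / δ * d z := by
    intro z hz
    have hC : 0 ≤ 2 ^ p / δ := by positivity
    by_cases hz' : ε ≤ |z.1 - z.2| ^ p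
    · have h1 : |z.1 - z.2| ^ p ≤ 2 ^ p := by
        refine Real.rpow_le_rpow (abs_nonneg _) ?_ hp0.le
        linarith [abs_sub z.1 z.2, hle z hz]
      have h2 : 2 ^ p / δ * δ ≤ 2 ^ p / δ * d z :=
        mul_le_mul_of_nonneg_left (hδS z ⟨hz, hz'⟩) hC
      rw [div_mul_cancel₀ _ hδ.ne'] at h2
      linarith
    · linarith [mul_nonneg hC (hd0 z)]
  refine ⟨2 ^ p / δ, by positivity, fun a b => ?_⟩
  have ha : 0 ≤ |a| ^ p := by positivity
  have hb : 0 ≤ |b| ^ p := by positivity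
  rcases (add_nonneg ha hb).eq_or_lt with h0 | hpos
  · have ha0 : a = 0 := by
      have : |a| ^ p = 0 := by linarith
      simpa [Real.rpow_eq_zero (abs_nonneg a) hp0.ne'] using this
    have hb0 : b = 0 := by
      have : |b| ^ p = 0 := by linarith
      simpa [Real.rpow_eq_zero (abs_nonneg b) hp0.ne'] using this
    simp [ha0, hb0, Real.zero_rpow hp0.ne']
  · set s := |a| ^ p + |b| ^ p with hs
    set r := s ^ (1 / p) with hr
    have hr0 : 0 < r := Real.rpow_pos_of_pos hpos _
    have hrp : r ^ p = s := by
      rw [hr, ← Real.rpow_mul hpos.le, one_div_mul_cancel hp0.ne', Real.rpow_one]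
    have hsc : ∀ c : ℝ, |c / r| ^ p = |c| ^ p / s := by
      intro c
      rw [abs_div, abs_of_pos hr0, Real.div_rpow (abs_nonneg _) hr0.le, hrp]
    have := hunit (a / r, b / r) (by
      simp only [hsc]
      rw [← add_div, ← hs, div_self hpos.ne'])
    simp only [d] at this
    rw [← sub_div, ← add_div, div_right_comm, hsc, hsc, hsc, hsc, ← add_div, ← hs,
      div_le_iff₀ hpos] at this
    calc |a - b| ^ p ≤ _ := this
      _ = _ := by field_simp

end Pointwise

/-- Existence and uniqueness of minimizers of `G u + ∑ i, ρ i (P a i + Q u i - y i)` for a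
coercive functional `G` that is uniformly convex on bounded sets. -/
lemma exists_unique_min_of_uniformly_convex {A F ι : Type*} [NormedAddCommGroup A]
    [NormedSpace ℝ A] [FiniteDimensional ℝ A] [NormedAddCommGroup F] [NormedSpace ℝ F]
    [CompleteSpace F] [Fintype ι] (G : F → ℝ) (hG : Continuous G) (hG0 : ∀ u, 0 ≤ G u)
    (hGbdd : ∀ M, ∃ R, ∀ u, G u ≤ M → ‖u‖ ≤ R)
    (hGmid : ∀ u v, G ((1 / 2 : ℝ) • (u + v)) ≤ (G u + G v) / 2)
    (hGunif : ∀ R, ∀ ε > 0, ∃ δ > 0, ∀ u v, ‖u‖ ≤ R → ‖v‖ ≤ R →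
      (G u + G v) / 2 - G ((1 / 2 : ℝ) • (u + v)) < δ → ‖u - v‖ < ε)
    (P : A →ₗ[ℝ] (ι → ℝ)) (hP : Function.Injective P) (Q : F →L[ℝ] (ι → ℝ))
    (ρ : ι → ℝ → ℝ) (y : ι → ℝ) (hρ : ∀ i, StrictConvexOn ℝ Set.univ (ρ i))
    (hρcont : ∀ i, Continuous (ρ i))
    (hρcoer : ∀ i, Filter.Tendsto (ρ i) (Filter.cocompact ℝ) Filter.atTop)
    (V : Set (A × F)) (hVne : V.Nonempty) (hVclosed : IsClosed V)
    (hVmid : ∀ z ∈ V, ∀ w ∈ V, (1 / 2 : ℝ) • (z + w) ∈ V) (J : A × F → ℝ)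
    (hJ : ∀ z, J z = G z.2 + ∑ i, ρ i (P z.1 i + Q z.2 i - y i)) :
    ∃ z ∈ V, (∀ w ∈ V, J z ≤ J w) ∧ ∀ w ∈ V, (∀ w' ∈ V, J w ≤ J w') → w = z := by
  have hPc : Continuous P := P.continuous_of_finiteDimensional
  have hJc : Continuous J := by
    rw [funext hJ]
    refine (hG.comp continuous_snd).add (continuous_finsetSum _ fun i _ => (hρcont i).comp ?_)
    exact (((continuous_apply i).comp (hPc.comp continuous_fst)).add
      ((continuous_apply i).comp (Q.continuous.comp continuous_snd))).sub continuous_const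
  have hmidval : ∀ z w : A × F, ∀ i, P ((1 / 2 : ℝ) • (z + w)).1 i +
      Q ((1 / 2 : ℝ) • (z + w)).2 i - y i = (1 / 2 : ℝ) • (P z.1 i + Q z.2 i - y i) +
        (1 / 2 : ℝ) • (P w.1 i + Q w.2 i - y i) := by
    intro z w i
    simp only [Prod.smul_fst, Prod.smul_snd, Prod.fst_add, Prod.snd_add, map_smul, map_add,
      Pi.smul_apply, Pi.add_apply, smul_eq_mul]
    ring
  have hρmid : ∀ z w : A × F, ∀ i, ρ i (P ((1 / 2 : ℝ) • (z + w)).1 i +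
      Q ((1 / 2 : ℝ) • (z + w)).2 i - y i) ≤ (ρ i (P z.1 i + Q z.2 i - y i) +
        ρ i (P w.1 i + Q w.2 i - y i)) / 2 := by
    intro z w i
    rw [hmidval]
    have := (hρ i).convexOn.2 (Set.mem_univ (P z.1 i + Q z.2 i - y i))
      (Set.mem_univ (P w.1 i + Q w.2 i - y i))
      (by norm_num : (0 : ℝ) ≤ 1 / 2) (by norm_num : (0 : ℝ) ≤ 1 / 2) (by norm_num)
    refine this.trans_eq ?_
    simp only [smul_eq_mul]
    ring
  have hsummid : ∀ z w : A × F, ∑ i, ρ i (P ((1 / 2 : ℝ) • (z + w)).1 i +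
      Q ((1 / 2 : ℝ) • (z + w)).2 i - y i) ≤ (∑ i, ρ i (P z.1 i + Q z.2 i - y i) +
        ∑ i, ρ i (P w.1 i + Q w.2 i - y i)) / 2 := by
    intro z w
    rw [← Finset.sum_add_distrib, Finset.sum_div]
    exact Finset.sum_le_sum fun i _ => hρmid z w i
  have hdefect : ∀ z w : A × F, (G z.2 + G w.2) / 2 - G ((1 / 2 : ℝ) • (z.2 + w.2)) ≤
      (J z + J w) / 2 - J ((1 / 2 : ℝ) • (z + w)) := by
    intro z w
    have := hsummid z w
    rw [hJ, hJ, hJ]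
    change _ ≤ _ - (G ((1 / 2 : ℝ) • (z.2 + w.2)) + _)
    linarith
  have hρlow : ∀ i, ∃ c, ∀ t, c ≤ ρ i t := fun i =>
    let ⟨t, ht⟩ := (hρcont i).exists_forall_le (hρcoer i)
    ⟨ρ i t, ht⟩
  choose c hc using hρlow
  have hJG : ∀ z, G z.2 + ∑ i, c i ≤ J z := fun z => by
    rw [hJ]
    gcongr
    exact hc _ _
  have hJρ : ∀ z i, ρ i (P z.1 i + Q z.2 i - y i) - c i + ∑ i, c i ≤ J z := fun z i => by
    have h1 : ρ i (P z.1 i + Q z.2 i - y i) - c i ≤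
        ∑ j, (ρ j (P z.1 j + Q z.2 j - y j) - c j) :=
      Finset.single_le_sum (f := fun j => ρ j (P z.1 j + Q z.2 j - y j) - c j)
        (fun j _ => sub_nonneg.mpr (hc j _)) (Finset.mem_univ i)
    rw [Finset.sum_sub_distrib] at h1
    rw [hJ]
    linarith [hG0 z.2]
  have hbdd : BddBelow (J '' V) := by
    refine ⟨∑ i, c i, ?_⟩
    rintro _ ⟨z, -, rfl⟩
    linarith [hJG z, hG0 z.2]
  obtain ⟨s, -, hs, hsV⟩ := exists_seq_tendsto_sInf (hVne.image J) hbdd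
  choose z hzV hzJ using hsV
  have hlim : Filter.Tendsto (fun n => J (z n)) Filter.atTop (nhds (sInf (J '' V))) := by
    simpa only [hzJ] using hs
  have hinf : ∀ w ∈ V, sInf (J '' V) ≤ J w := fun w hw => csInf_le hbdd ⟨w, hw, rfl⟩
  obtain ⟨M, hM⟩ := hlim.bddAbove_range
  have hM : ∀ n, J (z n) ≤ M := fun n => hM ⟨n, rfl⟩
  obtain ⟨R, hR⟩ := hGbdd (M - ∑ i, c i)
  have huR : ∀ n, ‖(z n).2‖ ≤ R := fun n => hR _ (by linarith [hJG (z n), hM n])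
  have hcauchy : CauchySeq fun n => (z n).2 := by
    refine Metric.cauchySeq_iff.mpr fun ε hε => ?_
    obtain ⟨δ, hδ, hδε⟩ := hGunif R ε hε
    obtain ⟨n₀, hn₀⟩ := Filter.eventually_atTop.mp
      (hlim.eventually (gt_mem_nhds (lt_add_of_pos_right _ hδ)))
    refine ⟨n₀, fun j hj k hk => ?_⟩
    rw [dist_eq_norm]
    refine hδε _ _ (huR j) (huR k) ((hdefect (z j) (z k)).trans_lt ?_)
    linarith [hn₀ j hj, hn₀ k hk, hinf _ (hVmid _ (hzV j) _ (hzV k))]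
  obtain ⟨u, hu⟩ := cauchySeq_tendsto_of_complete hcauchy
  have hPbdd : ∀ i, ∃ B, ∀ n, |P (z n).1 i| ≤ B := by
    intro i
    have hev := (hρcoer i).eventually_gt_atTop (M + c i - ∑ i, c i)
    obtain ⟨S, hS, hSsub⟩ := Filter.mem_cocompact.mp hev
    obtain ⟨B, hB⟩ := hS.isBounded.exists_norm_le
    refine ⟨B + ‖Q‖ * R + |y i|, fun n => ?_⟩
    have h1 : P (z n).1 i + Q (z n).2 i - y i ∈ S := by
      by_contra hn
      have : M + c i - ∑ i, c i < _ := hSsub hn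
      linarith [hJρ (z n) i, hM n]
    have h2 := hB _ h1
    have h3 : |Q (z n).2 i| ≤ ‖Q‖ * R :=
      ((norm_le_pi_norm (Q (z n).2) i).trans (Q.le_opNorm _)).trans
        (mul_le_mul_of_nonneg_left (huR n) (norm_nonneg _))
    rw [Real.norm_eq_abs] at h2
    have := abs_le.mp h2
    have := abs_le.mp h3
    have := neg_abs_le (y i)
    have := le_abs_self (y i)
    exact abs_le.mpr ⟨by linarith, by linarith⟩
  choose B hB using hPbdd
  obtain ⟨L, -, hL⟩ := P.exists_antilipschitzWith (LinearMap.ker_eq_bot.mpr hP)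
  have hbd : Bornology.IsBounded (P ⁻¹' Set.pi Set.univ fun i => Metric.closedBall 0 (B i)) :=
    hL.isBounded_preimage (Bornology.IsBounded.pi fun i => Metric.isBounded_closedBall)
  have := FiniteDimensional.proper ℝ A
  obtain ⟨a, -, φ, hφ, ha⟩ := tendsto_subseq_of_bounded hbd (x := fun n => (z n).1)
    (fun n i _ => by simpa using hB i n)
  have hz : Filter.Tendsto (z ∘ φ) Filter.atTop (nhds (a, u)) :=
    ha.prodMk_nhds (hu.comp hφ.tendsto_atTop)
  have hval : J (a, u) = sInf (J '' V) :=
    tendsto_nhds_unique ((hJc.tendsto _).comp hz) (hlim.comp hφ.tendsto_atTop)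
  have hmem : (a, u) ∈ V := hVclosed.mem_of_tendsto hz (.of_forall fun n => hzV _)
  refine ⟨(a, u), hmem, fun w hw => hval ▸ hinf w hw, fun w hw hwmin => ?_⟩
  have hwval : J w = sInf (J '' V) := le_antisymm (hval ▸ hwmin _ hmem) (hinf w hw)
  have hmid := hinf _ (hVmid w hw _ hmem)
  have hw2 : w.2 = u := by
    by_contra hne
    obtain ⟨δ, hδ, hδε⟩ := hGunif (max ‖w.2‖ ‖u‖) ‖w.2 - u‖
      (norm_pos_iff.mpr (sub_ne_zero.mpr hne))
    refine lt_irrefl _ (hδε w.2 u (le_max_left _ _) (le_max_right _ _)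
      ((hdefect w (a, u)).trans_lt ?_))
    linarith
  have hTeq : ∀ i, P w.1 i + Q w.2 i - y i = P a i + Q u i - y i := by
    intro i
    by_contra hne
    have hlt : ρ i (P ((1 / 2 : ℝ) • (w + (a, u))).1 i +
        Q ((1 / 2 : ℝ) • (w + (a, u))).2 i - y i) < (ρ i (P w.1 i + Q w.2 i - y i) +
          ρ i (P a i + Q u i - y i)) / 2 := by
      rw [hmidval]
      refine ((hρ i).2 (Set.mem_univ _) (Set.mem_univ _) hne
        (by norm_num : (0 : ℝ) < 1 / 2) (by norm_num : (0 : ℝ) < 1 / 2)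
        (by norm_num)).trans_eq ?_
      simp only [smul_eq_mul]
      ring
    have hsum : ∑ i, ρ i (P ((1 / 2 : ℝ) • (w + (a, u))).1 i +
        Q ((1 / 2 : ℝ) • (w + (a, u))).2 i - y i) < (∑ i, ρ i (P w.1 i + Q w.2 i - y i) +
          ∑ i, ρ i (P a i + Q u i - y i)) / 2 := by
      rw [← Finset.sum_add_distrib, Finset.sum_div]
      exact Finset.sum_lt_sum (fun j _ => hρmid w (a, u) j) ⟨i, Finset.mem_univ i, hlt⟩
    have hGm := hGmid w.2 u
    rw [hJ] at hmid hwval hval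
    change _ ≤ G ((1 / 2 : ℝ) • (w.2 + u)) + _ at hmid
    dsimp only at hval
    linarith
  have hw1 : w.1 = a := hP (funext fun i => by
    have := hTeq i
    rw [hw2] at this
    linarith)
  exact Prod.ext hw1 hw2

section LpSpace

variable {α : Type*} [MeasurableSpace α] {μ : Measure α} {p : ℝ}

lemma integrable_abs_rpow (hp : 1 < p) (u : Lp ℝ (ENNReal.ofReal p) μ) :
    Integrable (fun s => |u s| ^ p) μ := by
  have hp0 : 0 < p := by linarith
  have := (Lp.memLp u).integrable_norm_rpow (by simpa using hp0) ENNReal.ofReal_ne_top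
  simpa only [ENNReal.toReal_ofReal hp0.le, Real.norm_eq_abs] using this

lemma integral_abs_rpow_eq_norm_rpow (hp : 1 < p) (u : Lp ℝ (ENNReal.ofReal p) μ) :
    ∫ s, |u s| ^ p ∂μ = ‖u‖ ^ p := by
  have hp0 : 0 < p := by linarith
  have hi : 0 ≤ ∫ s, |u s| ^ p ∂μ := integral_nonneg fun s => by positivity
  rw [Lp.norm_def, (Lp.memLp u).eLpNorm_eq_integral_rpow_norm (by simpa using hp0)
    ENNReal.ofReal_ne_top]
  simp only [ENNReal.toReal_ofReal hp0.le, Real.norm_eq_abs]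
  rw [ENNReal.toReal_ofReal (Real.rpow_nonneg hi _), ← Real.rpow_mul hi,
    inv_mul_cancel₀ hp0.ne', Real.rpow_one]

lemma ae_abs_midpoint_rpow_eq (u v : Lp ℝ (ENNReal.ofReal p) μ) :
    (fun s => |((1 / 2 : ℝ) • (u + v) : Lp ℝ (ENNReal.ofReal p) μ) s| ^ p) =ᵐ[μ]
      fun s => |(u s + v s) / 2| ^ p := by
  filter_upwards [Lp.coeFn_smul (1 / 2 : ℝ) (u + v), Lp.coeFn_add u v] with s h1 h2
  rw [h1, Pi.smul_apply, h2, Pi.add_apply, smul_eq_mul, one_div_mul_eq_div]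

lemma norm_midpoint_rpow_le (hp : 1 < p) (u v : Lp ℝ (ENNReal.ofReal p) μ) :
    ‖(1 / 2 : ℝ) • (u + v)‖ ^ p ≤ (‖u‖ ^ p + ‖v‖ ^ p) / 2 := by
  have hu := integrable_abs_rpow hp u
  have hv := integrable_abs_rpow hp v
  simp only [← integral_abs_rpow_eq_norm_rpow hp]
  rw [integral_congr_ae (ae_abs_midpoint_rpow_eq u v), ← integral_add hu hv, ← integral_div]
  refine integral_mono ?_ ((hu.add hv).div_const 2) fun s => abs_midpoint_rpow_le hp _ _
  exact (integrable_abs_rpow hp _).congr (ae_abs_midpoint_rpow_eq u v)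

lemma exists_norm_sub_rpow_le (hp : 1 < p) {ε : ℝ} (hε : 0 < ε) :
    ∃ C, 0 ≤ C ∧ ∀ u v : Lp ℝ (ENNReal.ofReal p) μ, ‖u - v‖ ^ p ≤
      ε * (‖u‖ ^ p + ‖v‖ ^ p) +
        C * ((‖u‖ ^ p + ‖v‖ ^ p) / 2 - ‖(1 / 2 : ℝ) • (u + v)‖ ^ p) := by
  obtain ⟨C, hC, h⟩ := exists_abs_sub_rpow_le hp hε
  refine ⟨C, hC, fun u v => ?_⟩
  have hu := integrable_abs_rpow hp u
  have hv := integrable_abs_rpow hp v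
  have hadd : Integrable (fun s => |u s| ^ p + |v s| ^ p) μ := hu.add hv
  have huv := (integrable_abs_rpow hp ((1 / 2 : ℝ) • (u + v))).congr
    (ae_abs_midpoint_rpow_eq u v)
  have hdefect : Integrable (fun s => (|u s| ^ p + |v s| ^ p) / 2 -
      |(u s + v s) / 2| ^ p) μ := (hadd.div_const 2).sub huv
  have hsub : (fun s => |(u - v : Lp ℝ (ENNReal.ofReal p) μ) s| ^ p) =ᵐ[μ]
      fun s => |u s - v s| ^ p := by
    filter_upwards [Lp.coeFn_sub u v] with s hs
    rw [hs, Pi.sub_apply]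
  simp only [← integral_abs_rpow_eq_norm_rpow hp]
  rw [integral_congr_ae (ae_abs_midpoint_rpow_eq u v), integral_congr_ae hsub,
    ← integral_add hu hv, ← integral_div, ← integral_sub (hadd.div_const 2) huv,
    ← integral_const_mul, ← integral_const_mul, ← integral_add (hadd.const_mul ε)
      (hdefect.const_mul C)]
  exact integral_mono ((integrable_abs_rpow hp _).congr hsub) ((hadd.const_mul ε).add
      (hdefect.const_mul C)) fun s => h _ _

/-- The functional `c * ‖·‖ ^ p` on `L^p` is uniformly convex on bounded sets. -/
lemma exists_norm_sub_lt_of_midpoint_defect [Fact (1 ≤ ENNReal.ofReal p)]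
    (hp : 1 < p) {c : ℝ} (hc : 0 < c) (R : ℝ) {ε : ℝ} (hε : 0 < ε) :
    ∃ δ > 0, ∀ u v : Lp ℝ (ENNReal.ofReal p) μ, ‖u‖ ≤ R → ‖v‖ ≤ R →
      (c * ‖u‖ ^ p + c * ‖v‖ ^ p) / 2 - c * ‖(1 / 2 : ℝ) • (u + v)‖ ^ p < δ →
        ‖u - v‖ < ε := by
  have hp0 : 0 < p := by linarith
  have hεp : 0 < ε ^ p := Real.rpow_pos_of_pos hε p
  have hR : 0 ≤ |R| ^ p := by positivity
  obtain ⟨C, hC, h⟩ := exists_norm_sub_rpow_le (μ := μ) hp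
    (ε := ε ^ p / (4 * (|R| ^ p + 1))) (by positivity)
  refine ⟨c * (ε ^ p / (2 * (C + 1))), by positivity, fun u v hu hv hlt => ?_⟩
  have hu' : ‖u‖ ^ p ≤ |R| ^ p :=
    Real.rpow_le_rpow (norm_nonneg _) (hu.trans (le_abs_self R)) hp0.le
  have hv' : ‖v‖ ^ p ≤ |R| ^ p :=
    Real.rpow_le_rpow (norm_nonneg _) (hv.trans (le_abs_self R)) hp0.le
  have hd : (‖u‖ ^ p + ‖v‖ ^ p) / 2 - ‖(1 / 2 : ℝ) • (u + v)‖ ^ p <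
      ε ^ p / (2 * (C + 1)) := by
    refine lt_of_mul_lt_mul_left (lt_of_eq_of_lt ?_ hlt) hc.le
    ring
  have h1 : ε ^ p / (4 * (|R| ^ p + 1)) * (‖u‖ ^ p + ‖v‖ ^ p) < ε ^ p / 2 := by
    rw [div_mul_eq_mul_div, div_lt_div_iff₀ (by positivity) two_pos]
    nlinarith
  have h2 : C * ((‖u‖ ^ p + ‖v‖ ^ p) / 2 - ‖(1 / 2 : ℝ) • (u + v)‖ ^ p) ≤ ε ^ p / 2 := by
    refine (mul_le_mul_of_nonneg_left hd.le hC).trans ?_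
    rw [mul_div_assoc', div_le_div_iff₀ (by positivity) two_pos]
    nlinarith
  exact (Real.rpow_lt_rpow_iff (norm_nonneg _) hε.le hp0).mp (by linarith [h u v])

lemma integrable_coeFn_Lp [IsFiniteMeasure μ] [Fact (1 ≤ ENNReal.ofReal p)]
    (u : Lp ℝ (ENNReal.ofReal p) μ) : Integrable u μ :=
  (Lp.memLp u).integrable Fact.out

lemma integral_abs_le_norm [IsProbabilityMeasure μ] [Fact (1 ≤ ENNReal.ofReal p)]
    (u : Lp ℝ (ENNReal.ofReal p) μ) : ∫ s, |u s| ∂μ ≤ ‖u‖ := by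
  have h := eLpNorm_le_eLpNorm_of_exponent_le (μ := μ) (f := u)
    (Fact.out : 1 ≤ ENNReal.ofReal p) (Lp.aestronglyMeasurable u)
  calc ∫ s, |u s| ∂μ = (eLpNorm u 1 μ).toReal := by
        rw [eLpNorm_one_eq_lintegral_enorm]
        exact integral_norm_eq_lintegral_enorm (Lp.aestronglyMeasurable u)
    _ ≤ ‖u‖ := ENNReal.toReal_mono (Lp.eLpNorm_ne_top u) h

lemma isClosed_ae_mul_nonneg [Fact (1 ≤ ENNReal.ofReal p)] (χ : α → ℝ) :
    IsClosed {u : Lp ℝ (ENNReal.ofReal p) μ | ∀ᵐ t ∂μ, 0 ≤ χ t * u t} := by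
  refine isSeqClosed_iff_isClosed.mp fun v u hv hu => ?_
  obtain ⟨φ, -, hφ⟩ := (tendstoInMeasure_of_tendsto_Lp hu).exists_seq_tendsto_ae
  filter_upwards [hφ, ae_all_iff.mpr hv] with t h1 h2
  exact ge_of_tendsto' (h1.const_mul (χ t)) fun n => h2 (φ n)

end LpSpace

section Volterra

instance isProbabilityMeasure_restrict_Icc_zero_one :
    IsProbabilityMeasure (volume.restrict (Set.Icc (0 : ℝ) 1)) := ⟨by simp⟩

/-- The kernel of `q + 1`-fold integration from `0`. -/
noncomputable def volterraKernel (q : ℕ) (z : ℝ × ℝ) : ℝ :=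
  {z : ℝ × ℝ | 0 < z.2 ∧ z.2 ≤ z.1}.indicator
    (fun z => (z.1 - z.2) ^ q / (Nat.factorial q : ℝ)) z

lemma measurable_volterraKernel (q : ℕ) : Measurable (volterraKernel q) := by
  refine Measurable.indicator (by fun_prop) ?_
  exact (measurableSet_lt measurable_const measurable_snd).inter
    (measurableSet_le measurable_snd measurable_fst)

lemma abs_volterraKernel_le_one (q : ℕ) {t : ℝ} (ht : t ≤ 1) (s : ℝ) :
    |volterraKernel q (t, s)| ≤ 1 := by
  unfold volterraKernel
  by_cases h : (t, s) ∈ {z : ℝ × ℝ | 0 < z.2 ∧ z.2 ≤ z.1}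
  · rw [Set.indicator_of_mem h]
    obtain ⟨h1, h2⟩ : 0 < s ∧ s ≤ t := h
    have h3 : 0 ≤ t - s := by linarith
    have h4 : (1 : ℝ) ≤ Nat.factorial q := by exact_mod_cast Nat.factorial_pos q
    rw [abs_of_nonneg (by positivity), div_le_one (by linarith)]
    exact (pow_le_one₀ h3 (by linarith)).trans h4
  · rw [Set.indicator_of_notMem h, abs_zero]
    exact zero_le_one

lemma intervalIntegral_eq_integral_volterraKernel (q : ℕ) (u : ℝ → ℝ) {t : ℝ}
    (ht : t ∈ Set.Icc (0 : ℝ) 1) :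
    ∫ s in (0 : ℝ)..t, ((t - s) ^ q / (Nat.factorial q : ℝ)) * u s =
      ∫ s in Set.Icc (0 : ℝ) 1, volterraKernel q (t, s) * u s := by
  have hk : (fun s => volterraKernel q (t, s) * u s) = (Set.Ioc 0 t).indicator
      fun s => ((t - s) ^ q / (Nat.factorial q : ℝ)) * u s := by
    ext s
    unfold volterraKernel
    by_cases h : s ∈ Set.Ioc 0 t
    · rw [Set.indicator_of_mem h, Set.indicator_of_mem (show (t, s) ∈ _ from h)]
    · rw [Set.indicator_of_notMem h, Set.indicator_of_notMem (show (t, s) ∉ _ from h), zero_mul]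
  rw [intervalIntegral.integral_of_le ht.1, hk, setIntegral_indicator measurableSet_Ioc,
    Set.inter_eq_self_of_subset_right]
  exact Set.Ioc_subset_Icc_self.trans (Set.Icc_subset_Icc_right ht.2)

variable {p : ℝ}

/-- The real `L^p` space of the unit interval. -/
abbrev UnitIntervalLp (p : ℝ) : Type :=
  Lp ℝ (ENNReal.ofReal p) (volume.restrict (Set.Icc (0 : ℝ) 1))

lemma aestronglyMeasurable_volterra (q : ℕ) (u : UnitIntervalLp p) : AEStronglyMeasurable
    (fun t => ∫ s in (0 : ℝ)..t, ((t - s) ^ q / (Nat.factorial q : ℝ)) * u s)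
    (volume.restrict (Set.Icc (0 : ℝ) 1)) := by
  have h : StronglyMeasurable fun t =>
      ∫ s in Set.Icc (0 : ℝ) 1, volterraKernel q (t, s) * u s :=
    ((measurable_volterraKernel q).stronglyMeasurable.mul
      ((Lp.stronglyMeasurable u).comp_measurable measurable_snd)).integral_prod_right
  refine h.aestronglyMeasurable.congr ?_
  filter_upwards [ae_restrict_mem measurableSet_Icc] with t ht
  exact (intervalIntegral_eq_integral_volterraKernel q u ht).symm

variable [Fact (1 ≤ ENNReal.ofReal p)]

lemma integrable_volterraKernel_mul (q : ℕ) {t : ℝ} (ht : t ≤ 1) (u : UnitIntervalLp p) :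
    Integrable (fun s => volterraKernel q (t, s) * u s)
      (volume.restrict (Set.Icc (0 : ℝ) 1)) :=
  (integrable_coeFn_Lp u).bdd_mul
    ((measurable_volterraKernel q).comp measurable_prodMk_left).aestronglyMeasurable
    (.of_forall fun s => abs_volterraKernel_le_one q ht s)

/-- The value at `t` of the `q + 1`-fold integral of `u` from `0`. -/
noncomputable def volterraCLM (p : ℝ) [Fact (1 ≤ ENNReal.ofReal p)] (q : ℕ)
    (t : Set.Icc (0 : ℝ) 1) : UnitIntervalLp p →L[ℝ] ℝ :=
  LinearMap.mkContinuous
    { toFun := fun u => ∫ s in Set.Icc (0 : ℝ) 1, volterraKernel q (t, s) * u s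
      map_add' := fun u v => by
        rw [← integral_add (integrable_volterraKernel_mul q t.2.2 u)
          (integrable_volterraKernel_mul q t.2.2 v)]
        refine integral_congr_ae ?_
        filter_upwards [Lp.coeFn_add u v] with s hs
        rw [hs, Pi.add_apply, mul_add]
      map_smul' := fun c u => by
        rw [RingHom.id_apply, smul_eq_mul, ← integral_const_mul]
        refine integral_congr_ae ?_
        filter_upwards [Lp.coeFn_smul c u] with s hs
        rw [hs, Pi.smul_apply, smul_eq_mul, mul_left_comm] } 1 fun u => by
    rw [one_mul]
    refine (norm_integral_le_of_norm_le (integrable_coeFn_Lp u).norm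
      (.of_forall fun s => ?_)).trans (integral_abs_le_norm u)
    rw [norm_mul]
    exact mul_le_of_le_one_left (norm_nonneg _) (abs_volterraKernel_le_one q t.2.2 s)

lemma volterraCLM_apply (q : ℕ) (t : Set.Icc (0 : ℝ) 1) (u : UnitIntervalLp p) :
    volterraCLM p q t u =
      ∫ s in (0 : ℝ)..t, (((t : ℝ) - s) ^ q / (Nat.factorial q : ℝ)) * u s :=
  (intervalIntegral_eq_integral_volterraKernel q u t.2).symm

lemma abs_volterra_le_norm (q : ℕ) {t : ℝ} (ht : t ∈ Set.Icc (0 : ℝ) 1) (u : UnitIntervalLp p) :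
    |∫ s in (0 : ℝ)..t, ((t - s) ^ q / (Nat.factorial q : ℝ)) * u s| ≤ ‖u‖ := by
  rw [← volterraCLM_apply q ⟨t, ht⟩, ← Real.norm_eq_abs]
  exact (ContinuousLinearMap.le_of_opNorm_le _
    (LinearMap.mkContinuous_norm_le _ zero_le_one _) u).trans_eq (one_mul _)

lemma integrable_mul_volterra (q : ℕ) {h : ℝ → ℝ} (hh : ContinuousOn h (Set.Icc 0 1))
    (u : UnitIntervalLp p) : Integrable
    (fun t => h t * ∫ s in (0 : ℝ)..t, ((t - s) ^ q / (Nat.factorial q : ℝ)) * u s)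
    (volume.restrict (Set.Icc (0 : ℝ) 1)) := by
  refine (hh.integrableOn_Icc).mul_bdd (c := ‖u‖) (aestronglyMeasurable_volterra q u) ?_
  filter_upwards [ae_restrict_mem measurableSet_Icc] with t ht
  exact abs_volterra_le_norm q ht u

lemma exists_clm_integral_mul_volterra (q : ℕ) {h : ℝ → ℝ}
    (hh : ContinuousOn h (Set.Icc 0 1)) : ∃ T : UnitIntervalLp p →L[ℝ] ℝ, ∀ u, T u =
      ∫ t in Set.Icc (0 : ℝ) 1, h t *
        ∫ s in (0 : ℝ)..t, ((t - s) ^ q / (Nat.factorial q : ℝ)) * u s := by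
  refine ⟨LinearMap.mkContinuous
    { toFun := fun u => ∫ t in Set.Icc (0 : ℝ) 1, h t *
        ∫ s in (0 : ℝ)..t, ((t - s) ^ q / (Nat.factorial q : ℝ)) * u s
      map_add' := fun u v => ?_
      map_smul' := fun c u => ?_ } (∫ t in Set.Icc (0 : ℝ) 1, |h t|) fun u => ?_,
    fun u => rfl⟩
  · rw [← integral_add (integrable_mul_volterra q hh u) (integrable_mul_volterra q hh v)]
    refine setIntegral_congr_fun measurableSet_Icc fun t ht => ?_
    have := map_add (volterraCLM p q ⟨t, ht⟩) u v
    simp only [volterraCLM_apply] at this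
    simp only [this, mul_add]
  · rw [RingHom.id_apply, smul_eq_mul, ← integral_const_mul]
    refine setIntegral_congr_fun measurableSet_Icc fun t ht => ?_
    have := map_smul (volterraCLM p q ⟨t, ht⟩) c u
    simp only [volterraCLM_apply, smul_eq_mul] at this
    simp only [this, mul_left_comm]
  · rw [← integral_mul_const]
    refine norm_integral_le_of_norm_le (hh.integrableOn_Icc.abs.mul_const _) ?_
    filter_upwards [ae_restrict_mem measurableSet_Icc] with t ht
    rw [norm_mul]
    exact mul_le_mul_of_nonneg_left (abs_volterra_le_norm q ht u) (norm_nonneg _)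

end Volterra

section Polynomial

/-- The `l`-th derivative at `t` of the polynomial with derivatives `a` at `0`. -/
noncomputable def taylorDeriv (m l : ℕ) (t : ℝ) : (Fin m → ℝ) →ₗ[ℝ] ℝ :=
  ∑ j : Fin m, (if l ≤ (j : ℕ) then t ^ ((j : ℕ) - l) / (Nat.factorial ((j : ℕ) - l) : ℝ)
    else 0) • LinearMap.proj j

lemma taylorDeriv_apply (m l : ℕ) (t : ℝ) (a : Fin m → ℝ) :
    taylorDeriv m l t a = ∑ j : Fin m, if l ≤ (j : ℕ) then
      a j * t ^ ((j : ℕ) - l) / (Nat.factorial ((j : ℕ) - l) : ℝ) else 0 := by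
  simp only [taylorDeriv, LinearMap.sum_apply, LinearMap.smul_apply, LinearMap.proj_apply,
    smul_eq_mul, ite_mul, zero_mul]
  refine Finset.sum_congr rfl fun j _ => ?_
  split_ifs
  · ring
  · rfl

lemma taylorDeriv_zero_apply (m : ℕ) (t : ℝ) (a : Fin m → ℝ) :
    taylorDeriv m 0 t a = ∑ j : Fin m, a j * t ^ (j : ℕ) / (Nat.factorial (j : ℕ) : ℝ) := by
  simp [taylorDeriv_apply]

lemma integrable_mul_taylorDeriv (m : ℕ) {h : ℝ → ℝ} (hh : ContinuousOn h (Set.Icc 0 1))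
    (a : Fin m → ℝ) : Integrable (fun t => h t * taylorDeriv m 0 t a)
      (volume.restrict (Set.Icc (0 : ℝ) 1)) := by
  simp only [taylorDeriv_zero_apply]
  exact (hh.mul (by fun_prop)).integrableOn_Icc

/-- Integration of polynomials against a family of continuous functions. -/
lemma exists_linearMap_integral_mul_taylorDeriv (m : ℕ) {ι : Type*} {h : ι → ℝ → ℝ}
    (hh : ∀ i, ContinuousOn (h i) (Set.Icc 0 1)) :
    ∃ P : (Fin m → ℝ) →ₗ[ℝ] (ι → ℝ), ∀ a i,
      P a i = ∫ t in Set.Icc (0 : ℝ) 1, h i t * taylorDeriv m 0 t a :=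
  ⟨{ toFun := fun a i => ∫ t in Set.Icc (0 : ℝ) 1, h i t * taylorDeriv m 0 t a
     map_add' := fun a b => by
       ext i
       simp only [Pi.add_apply, map_add, mul_add]
       exact integral_add (integrable_mul_taylorDeriv m (hh i) a)
         (integrable_mul_taylorDeriv m (hh i) b)
     map_smul' := fun c a => by
       ext i
       simp only [Pi.smul_apply, map_smul, smul_eq_mul, RingHom.id_apply, mul_left_comm _ c]
       exact integral_const_mul c _ }, fun _ _ => rfl⟩

end Polynomial

lemma mem_Icc_zero_one_of_mem_Icc {K : ℕ} {x : ℕ → ℝ} (hx0 : x 0 = 0) (hxK : x (K + 1) = 1)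
    (hmono : ∀ k ≤ K, x k ≤ x (k + 1)) {k : ℕ} (hk : k ≤ K) {t : ℝ}
    (ht : t ∈ Set.Icc (x k) (x (k + 1))) : t ∈ Set.Icc (0 : ℝ) 1 := by
  have h1 : ∀ n ≤ K + 1, 0 ≤ x n := fun n => by
    induction n with
    | zero => exact fun _ => hx0.ge
    | succ n ih => exact fun hn => (ih (by omega)).trans (hmono n (by omega))
  have h2 : ∀ d ≤ K + 1, x (K + 1 - d) ≤ 1 := fun d => by
    induction d with
    | zero => exact fun _ => hxK.le
    | succ d ih =>
      intro hd
      have := hmono (K + 1 - (d + 1)) (by omega)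
      rw [show K + 1 - (d + 1) + 1 = K + 1 - d by omega] at this
      exact this.trans (ih (by omega))
  have h3 := h2 (K - k) (by omega)
  rw [show K + 1 - (K - k) = k + 1 by omega] at h3
  exact ⟨(h1 k (by omega)).trans ht.1, ht.2.trans h3⟩

/-- The penalized likelihood
`J(a,u) = (λ/p)∫₀¹|u|^p + ∑ᵢ ρᵢ(∫₀¹ hᵢ f_{a,u} - yᵢ)`, with `hᵢ` separating polynomials of
degree `m-1` and `ρᵢ` strictly convex, continuous and coercive, attains its infimum over the
constraint cone `V^{K,ℓ}[x] ⊆ ℝ^m × L^p([0,1])` at a unique minimizer. -/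
theorem penalized_likelihood_min_exists_unique (m : ℕ) (hm : 1 ≤ m)
    (l : ℕ) (hl : l ≤ m) (p : ℝ) (hp : 1 < p) (lam : ℝ) (hlam : 0 < lam)
    (K : ℕ) (x : ℕ → ℝ) (hx0 : x 0 = 0) (hxK : x (K + 1) = 1)
    (hmono : ∀ k ≤ K, x k ≤ x (k + 1))
    (N : ℕ) (h : Fin N → ℝ → ℝ) (hcont : ∀ i, ContinuousOn (h i) (Set.Icc 0 1))
    (hsep : ∀ b : Fin m → ℝ,
      (∀ i, ∫ t in Set.Icc (0 : ℝ) 1, h i t * (∑ j : Fin m, b j * t ^ (j : ℕ)) = 0) → b = 0)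
    (y : Fin N → ℝ) (ρ : Fin N → ℝ → ℝ)
    (hρ : ∀ i, StrictConvexOn ℝ Set.univ (ρ i))
    (hρcont : ∀ i, Continuous (ρ i))
    (hρcoer : ∀ i, Filter.Tendsto (ρ i) (Filter.cocompact ℝ) Filter.atTop)
    [Fact (1 ≤ ENNReal.ofReal p)] :
    let μ := volume.restrict (Set.Icc (0 : ℝ) 1)
    let J : (Fin m → ℝ) × Lp ℝ (ENNReal.ofReal p) μ → ℝ := fun z =>
      (lam / p) * (∫ s in Set.Icc (0 : ℝ) 1, |(z.2 : ℝ → ℝ) s| ^ p)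
        + ∑ i, ρ i ((∫ t in Set.Icc (0 : ℝ) 1, h i t * fAU m z.1 (z.2 : ℝ → ℝ) t) - y i)
    let V : Set ((Fin m → ℝ) × Lp ℝ (ENNReal.ofReal p) μ) :=
      {z | if l < m then
            ∀ k ≤ K, ∀ t ∈ Set.Icc (x k) (x (k + 1)),
              0 ≤ (-1 : ℝ) ^ k * fAUDeriv m l z.1 (z.2 : ℝ → ℝ) t
          else
            ∀ᵐ t ∂μ, 0 ≤ chgSign K x t * (z.2 : ℝ → ℝ) t}
    ∃ z ∈ V, (∀ w ∈ V, J z ≤ J w) ∧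
      ∀ w ∈ V, (∀ w' ∈ V, J w ≤ J w') → w = z := by
  intro μ J V
  have hp0 : 0 < p := by linarith
  have hc : 0 < lam / p := div_pos hlam hp0
  obtain ⟨P, hP⟩ := exists_linearMap_integral_mul_taylorDeriv m hcont
  choose T hT using fun i => exists_clm_integral_mul_volterra (p := p) (m - 1) (hcont i)
  have hPinj : Function.Injective P := by
    refine (injective_iff_map_eq_zero P).mpr fun a ha => ?_
    have hb := hsep (fun j => a j / (Nat.factorial (j : ℕ) : ℝ)) fun i => by
      have := congrFun ha i
      rw [hP] at this
      simpa only [taylorDeriv_zero_apply, mul_div_right_comm, Pi.zero_apply] using this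
    ext j
    have := congrFun hb j
    have hj : (Nat.factorial (j : ℕ) : ℝ) ≠ 0 := by exact_mod_cast Nat.factorial_ne_zero _
    simpa [hj] using this
  have hJ : ∀ z, J z = lam / p * ‖z.2‖ ^ p +
      ∑ i, ρ i (P z.1 i + ContinuousLinearMap.pi T z.2 i - y i) := by
    intro z
    simp only [J]
    rw [← integral_abs_rpow_eq_norm_rpow hp]
    congr 1
    refine Finset.sum_congr rfl fun i _ => ?_
    rw [hP, ContinuousLinearMap.pi_apply, hT,
      ← integral_add (integrable_mul_taylorDeriv m (hcont i) z.1)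
        (integrable_mul_volterra (m - 1) (hcont i) z.2)]
    simp only [fAU, taylorDeriv_zero_apply, mul_add]
  have hD : ∀ (t : Set.Icc (0 : ℝ) 1) (z : (Fin m → ℝ) × Lp ℝ (ENNReal.ofReal p) μ),
      fAUDeriv m l z.1 z.2 t = taylorDeriv m l t z.1 + volterraCLM p (m - l - 1) t z.2 := by
    intro t z
    rw [taylorDeriv_apply, volterraCLM_apply, fAUDeriv]
  have hVzero : (0 : (Fin m → ℝ) × Lp ℝ (ENNReal.ofReal p) μ) ∈ V := by
    change if _ then _ else _
    split_ifs with hlm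
    · intro k hk t ht
      rw [hD ⟨t, mem_Icc_zero_one_of_mem_Icc hx0 hxK hmono hk ht⟩]
      simp
    · filter_upwards [Lp.coeFn_zero ℝ (ENNReal.ofReal p) μ] with t ht
      change 0 ≤ chgSign K x t * (0 : Lp ℝ (ENNReal.ofReal p) μ) t
      rw [ht, Pi.zero_apply, mul_zero]
  have hVclosed : IsClosed V := by
    simp only [V]
    split_ifs with hlm
    · simp only [Set.ofPred_forall]
      refine isClosed_iInter fun k => isClosed_iInter fun hk => isClosed_iInter fun t =>
        isClosed_iInter fun ht => isClosed_le continuous_const (continuous_const.mul ?_)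
      rw [funext (hD ⟨t, mem_Icc_zero_one_of_mem_Icc hx0 hxK hmono hk ht⟩)]
      exact ((LinearMap.continuous_of_finiteDimensional _).comp continuous_fst).add
        ((ContinuousLinearMap.continuous _).comp continuous_snd)
    · exact (isClosed_ae_mul_nonneg (chgSign K x)).preimage continuous_snd
  have hVmid : ∀ z ∈ V, ∀ w ∈ V, (1 / 2 : ℝ) • (z + w) ∈ V := by
    intro z hz w hw
    simp only [V, Set.mem_ofPred_eq] at hz hw ⊢
    split_ifs at hz hw ⊢ with hlm
    · intro k hk t ht
      have h1 := hz k hk t ht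
      have h2 := hw k hk t ht
      rw [hD ⟨t, mem_Icc_zero_one_of_mem_Icc hx0 hxK hmono hk ht⟩] at h1 h2 ⊢
      simp only [Prod.smul_fst, Prod.smul_snd, Prod.fst_add, Prod.snd_add, map_smul, map_add,
        smul_eq_mul]
      linarith
    · filter_upwards [hz, hw, Lp.coeFn_smul (1 / 2 : ℝ) (z.2 + w.2), Lp.coeFn_add z.2 w.2]
        with t h1 h2 h3 h4
      rw [Prod.smul_snd, Prod.snd_add, h3, Pi.smul_apply, h4, Pi.add_apply, smul_eq_mul]
      linarith
  refine exists_unique_min_of_uniformly_convex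
    (fun u : Lp ℝ (ENNReal.ofReal p) μ => lam / p * ‖u‖ ^ p) ?_ (fun u => by positivity) ?_ ?_
    (fun R ε hε => exists_norm_sub_lt_of_midpoint_defect hp hc R hε) P hPinj
    (ContinuousLinearMap.pi T) ρ y hρ hρcont hρcoer V ⟨0, hVzero⟩ hVclosed hVmid J hJ
  · exact continuous_const.mul (continuous_norm.rpow_const fun _ => Or.inr hp0.le)
  · intro M
    refine ⟨(|M| / (lam / p)) ^ p⁻¹, fun u hu => ?_⟩
    rw [Real.le_rpow_inv_iff_of_pos (norm_nonneg _) (by positivity) hp0, le_div_iff₀' hc]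
    exact hu.trans (le_abs_self M)
  · intro u v
    refine (mul_le_mul_of_nonneg_left (norm_midpoint_rpow_le hp u v) hc.le).trans_eq ?_
    ring
end

section
/- Let m ≥ 2, K ≥ 0, and fix change points 0 = x₀ ≤ x₁ ≤ … ≤ x_K ≤ x_{K+1} = 1 with associated sign function χ_x. Suppose g : ℝ → ℝ is (m+2) times continuously differentiable on [0,1] and satisfies: g^(j)(0) = 0 for j = 0,…,m−3; χ_x(t) g^(m+2)(t) ≤ 0 for all t ∈ [0,1]; g^(m)(1) = 0; χ_x(1) g^(m+1)(1) ≥ 0; g^(m−1)(0) = g^(m)(0); and χ_x(0)·[ g^(m−2)(0) + g^(m+1)(0) ] ≤ 0. Then for every f : ℝ → ℝ that is m times continuously differentiable on [0,1] with (−1)^{k−1} f^(m−2)(t) ≥ 0 for all t ∈ [x_{k−1}, x_k] and all k = 1,…,K+1, one has ⟪g,f⟫ ≤ 0; that is, g belongs to the negative polar cone of V^{K,m−2}[x]. -/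
/-- If `F` has the sign prescribed by the change points, then multiplying by `F t` respects
nonpositivity of products with `chgSign K x t`. -/
theorem mul_nonpos_of_chgSign_mul_nonpos {K : ℕ} {x : ℕ → ℝ} (hx0 : x 0 = 0)
    (hxK : x (K + 1) = 1) (hmono : ∀ k ≤ K, x k ≤ x (k + 1)) {F : ℝ → ℝ}
    (hF : ∀ k ≤ K, ∀ t ∈ Set.Icc (x k) (x (k + 1)), 0 ≤ (-1 : ℝ) ^ k * F t)
    {t c : ℝ} (ht : t ∈ Set.Icc (0 : ℝ) 1) (hc : chgSign K x t * c ≤ 0) : F t * c ≤ 0 := by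
  have key : ∀ k ≤ K, t ∈ Set.Icc (x k) (x (k + 1)) → (-1 : ℝ) ^ k * c ≤ 0 → F t * c ≤ 0 := by
    intro k hk htk h
    have h1 := mul_nonpos_of_nonneg_of_nonpos (hF k hk t htk) h
    have h2 : ((-1 : ℝ) ^ k) * (-1) ^ k = 1 := by rw [← mul_pow]; norm_num
    calc F t * c = ((-1 : ℝ) ^ k * (-1) ^ k) * (F t * c) := by rw [h2, one_mul]
      _ = (-1 : ℝ) ^ k * F t * ((-1) ^ k * c) := by ring
      _ ≤ 0 := h1
  have hnonneg : ∀ k ≤ K + 1, 0 ≤ x k := by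
    intro k
    induction k with
    | zero => intro _; exact hx0.ge
    | succ k ih => intro hk; exact (ih (by omega)).trans (hmono k (by omega))
  have hle_one : ∀ j ≤ K + 1, x (K + 1 - j) ≤ 1 := by
    intro j
    induction j with
    | zero => intro _; exact hxK.le
    | succ j ih =>
      intro hj
      have h := hmono (K + 1 - (j + 1)) (by omega)
      rw [show K + 1 - (j + 1) + 1 = K + 1 - j by omega] at h
      exact h.trans (ih (by omega))
  have hcover : ∀ n ≤ K + 1, t ≤ x n → ∃ k ≤ K, t ∈ Set.Icc (x k) (x (k + 1)) := by
    intro n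
    induction n with
    | zero =>
      intro _ h
      exact ⟨0, K.zero_le, hx0.trans_le ht.1, h.trans (hmono 0 K.zero_le)⟩
    | succ n ih =>
      intro hn h
      rcases le_total t (x n) with h' | h'
      · exact ih (by omega) h'
      · exact ⟨n, by omega, h', h⟩
  classical
  by_cases h : ∃ k, k ≤ K ∧ x k < t ∧ t < x (k + 1)
  · rw [chgSign, dif_pos h] at hc
    have hs := Nat.find_spec h
    exact key _ hs.1 ⟨hs.2.1.le, hs.2.2.le⟩ (by convert hc)
  rw [chgSign, dif_neg h] at hc
  by_cases ht0 : t = 0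
  · have h0 : ∃ k, k ≤ K ∧ (0 : ℝ) < x (k + 1) := ⟨K, le_rfl, by rw [hxK]; exact one_pos⟩
    rw [if_pos ht0, dif_pos h0] at hc
    have hs := Nat.find_spec h0
    refine key (Nat.find h0) hs.1 ⟨?_, by rw [ht0]; exact hs.2.le⟩ (by convert hc)
    rcases hk : Nat.find h0 with _ | k
    · rw [hx0, ht0]
    · have hmin := Nat.find_min h0 (m := k) (by omega)
      rw [ht0]
      by_contra! hpos
      exact hmin ⟨by omega, hpos⟩
  rw [if_neg ht0] at hc
  by_cases ht1 : t = 1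
  · have h1 : ∃ j, j ≤ K ∧ x (K - j) < 1 := ⟨K, le_rfl, by rw [Nat.sub_self, hx0]; exact one_pos⟩
    rw [if_pos ht1, dif_pos h1] at hc
    have hs := Nat.find_spec h1
    refine key (K - Nat.find h1) (Nat.sub_le _ _) ⟨by rw [ht1]; exact hs.2.le, ?_⟩
      (by convert hc)
    rcases hj : Nat.find h1 with _ | j
    · rw [Nat.sub_zero, hxK, ht1]
    · have hmin := Nat.find_min h1 (m := j) (by omega)
      rw [ht1, show K - (j + 1) + 1 = K - j by omega]
      by_contra! hlt
      exact hmin ⟨by omega, hlt⟩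
  have hzero : ∀ k, k + 1 ≤ K → t = x (k + 1) → F t * c ≤ 0 := by
    intro k hk htk
    have ha := hF k (by omega) t ⟨by rw [htk]; exact hmono k (by omega), htk.le⟩
    have hb := hF (k + 1) hk t ⟨htk.ge, by rw [htk]; exact hmono (k + 1) hk⟩
    rw [pow_succ] at hb
    have hprod : (-1 : ℝ) ^ k * F t = 0 := by linarith
    have hFt : F t = 0 := (mul_eq_zero.mp hprod).resolve_left (pow_ne_zero _ (by norm_num))
    rw [hFt, zero_mul]
  obtain ⟨k, hk, hl, hr⟩ := hcover (K + 1) le_rfl (by rw [hxK]; exact ht.2)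
  rcases hl.eq_or_lt with hl' | hl'
  · rcases k with _ | k
    · exact absurd (hl'.symm.trans hx0) ht0
    · exact hzero k hk hl'.symm
  rcases hr.eq_or_lt with hr' | hr'
  · rcases hk.eq_or_lt with rfl | hk'
    · exact absurd (hr'.trans hxK) ht1
    · exact hzero k hk' hr'
  exact absurd ⟨k, hk, hl', hr'⟩ h

/-- Inside `[0,1]`, the iterated derivatives within `[0,1]` differentiate to one another. -/
theorem hasDerivAt_iteratedDerivWithin_Icc {f : ℝ → ℝ} {N n : ℕ}
    (hf : ContDiffOn ℝ N f (Set.Icc 0 1)) (hn : n < N) {t : ℝ} (ht : t ∈ Set.Ioo (0 : ℝ) 1) :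
    HasDerivAt (iteratedDerivWithin n f (Set.Icc 0 1))
      (iteratedDerivWithin (n + 1) f (Set.Icc 0 1) t) t := by
  rw [iteratedDerivWithin_succ]
  exact ((hf.differentiableOn_iteratedDerivWithin (by exact_mod_cast hn)
    (uniqueDiffOn_Icc one_pos) t (Set.Ioo_subset_Icc_self ht)).hasDerivWithinAt).hasDerivAt
    (Icc_mem_nhds ht.1 ht.2)

/-- Two integrations by parts on `[0,1]`. -/
theorem integral_mul_deriv_two_eq {F F' F'' G G' G'' : ℝ → ℝ}
    (hF : ContinuousOn F (Set.Icc 0 1)) (hF' : ContinuousOn F' (Set.Icc 0 1))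
    (hF'' : ContinuousOn F'' (Set.Icc 0 1)) (hG : ContinuousOn G (Set.Icc 0 1))
    (hG' : ContinuousOn G' (Set.Icc 0 1)) (hG'' : ContinuousOn G'' (Set.Icc 0 1))
    (hdF : ∀ t ∈ Set.Ioo (0 : ℝ) 1, HasDerivAt F (F' t) t)
    (hdF' : ∀ t ∈ Set.Ioo (0 : ℝ) 1, HasDerivAt F' (F'' t) t)
    (hdG : ∀ t ∈ Set.Ioo (0 : ℝ) 1, HasDerivAt G (G' t) t)
    (hdG' : ∀ t ∈ Set.Ioo (0 : ℝ) 1, HasDerivAt G' (G'' t) t) :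
    ∫ t in (0 : ℝ)..1, F'' t * G t =
      F' 1 * G 1 - F 1 * G' 1 - (F' 0 * G 0 - F 0 * G' 0) + ∫ t in (0 : ℝ)..1, F t * G'' t := by
  have hi₁ : IntervalIntegrable (fun t => F'' t * G t) MeasureTheory.volume 0 1 :=
    (hF''.mul hG).intervalIntegrable_of_Icc zero_le_one
  have hi₂ : IntervalIntegrable (fun t => F t * G'' t) MeasureTheory.volume 0 1 :=
    (hF.mul hG'').intervalIntegrable_of_Icc zero_le_one
  have h := intervalIntegral.integral_eq_sub_of_hasDerivAt_of_le zero_le_one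
    (f := fun t => F' t * G t - F t * G' t) (f' := fun t => F'' t * G t - F t * G'' t)
    ((hF'.mul hG).sub (hF.mul hG')) (fun t ht => by
      have hd := ((hdF' t ht).mul (hdG t ht)).sub ((hdF t ht).mul (hdG' t ht))
      exact hd.congr_deriv (by ring)) (hi₁.sub hi₂)
  rw [intervalIntegral.integral_sub hi₁ hi₂] at h
  linarith

/-- Membership in the negative polar cone of `V^{K,m-2}[x]`:
if `g ∈ C^{m+2}[0,1]` satisfies `g^(j)(0) = 0` for `j ≤ m-3`, `χ_x g^(m+2) ≤ 0` on `[0,1]`,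
`g^(m)(1) = 0`, `χ_x(1) g^(m+1)(1) ≥ 0`, `g^(m-1)(0) = g^(m)(0)` and
`χ_x(0)(g^(m-2)(0) + g^(m+1)(0)) ≤ 0`, then `⟪g,f⟫ ≤ 0` for every `f ∈ C^m[0,1]` with
`(-1)^{k-1} f^(m-2) ≥ 0` on `[x_{k-1}, x_k]` for all `k`. -/
theorem negative_polar_membership_ell_m_sub_two (m K : ℕ) (hm : 2 ≤ m)
    (x : ℕ → ℝ) (hx0 : x 0 = 0) (hxK : x (K + 1) = 1)
    (hmono : ∀ k ≤ K, x k ≤ x (k + 1))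
    (g : ℝ → ℝ) (hg : ContDiffOn ℝ (m + 2) g (Set.Icc 0 1))
    (hg0 : ∀ j : ℕ, j + 3 ≤ m → iteratedDerivWithin j g (Set.Icc 0 1) 0 = 0)
    (hga : ∀ t ∈ Set.Icc (0 : ℝ) 1,
      chgSign K x t * iteratedDerivWithin (m + 2) g (Set.Icc 0 1) t ≤ 0)
    (hgb : iteratedDerivWithin m g (Set.Icc 0 1) 1 = 0)
    (hgc : 0 ≤ chgSign K x 1 * iteratedDerivWithin (m + 1) g (Set.Icc 0 1) 1)
    (hgd : iteratedDerivWithin (m - 1) g (Set.Icc 0 1) 0 =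
      iteratedDerivWithin m g (Set.Icc 0 1) 0)
    (hge : chgSign K x 0 *
      (iteratedDerivWithin (m - 2) g (Set.Icc 0 1) 0 +
        iteratedDerivWithin (m + 1) g (Set.Icc 0 1) 0) ≤ 0) :
    ∀ f : ℝ → ℝ, ContDiffOn ℝ m f (Set.Icc 0 1) →
      (∀ k ≤ K, ∀ t ∈ Set.Icc (x k) (x (k + 1)),
        0 ≤ (-1 : ℝ) ^ k * iteratedDerivWithin (m - 2) f (Set.Icc 0 1) t) →
      dualPairing m g f ≤ 0 := by
  obtain ⟨n, rfl⟩ : ∃ n, m = n + 2 := ⟨m - 2, by omega⟩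
  rw [show n + 2 - 1 = n + 1 by omega] at hgd
  rw [Nat.add_sub_cancel] at hge ⊢
  intro f hf hsign
  have hg' : ContDiffOn ℝ ((n + 4 : ℕ) : WithTop ℕ∞) g (Set.Icc 0 1) := by
    refine hg.of_le (le_of_eq ?_)
    push_cast
    rw [add_assoc]
    norm_num
  have hu := uniqueDiffOn_Icc (zero_lt_one (α := ℝ))
  have hcf : ∀ j ≤ n + 2, ContinuousOn (iteratedDerivWithin j f (Set.Icc 0 1)) (Set.Icc 0 1) :=
    fun j hj => hf.continuousOn_iteratedDerivWithin (by exact_mod_cast hj) hu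
  have hcg : ∀ j ≤ n + 4, ContinuousOn (iteratedDerivWithin j g (Set.Icc 0 1)) (Set.Icc 0 1) :=
    fun j hj => hg'.continuousOn_iteratedDerivWithin (by exact_mod_cast hj) hu
  have hparts := integral_mul_deriv_two_eq (hcf n (by omega)) (hcf (n + 1) (by omega))
    (hcf (n + 2) le_rfl) (hcg (n + 2) (by omega)) (hcg (n + 3) (by omega)) (hcg (n + 4) le_rfl)
    (fun t ht => hasDerivAt_iteratedDerivWithin_Icc hf (by omega) ht)
    (fun t ht => hasDerivAt_iteratedDerivWithin_Icc hf (by omega) ht)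
    (fun t ht => hasDerivAt_iteratedDerivWithin_Icc hg' (by omega) ht)
    (fun t ht => hasDerivAt_iteratedDerivWithin_Icc hg' (by omega) ht)
  have hsum : ∑ j ∈ Finset.range n,
      iteratedDerivWithin j g (Set.Icc 0 1) 0 * iteratedDerivWithin j f (Set.Icc 0 1) 0 = 0 :=
    Finset.sum_eq_zero fun j hj => by
      rw [hg0 j (by have := Finset.mem_range.mp hj; omega), zero_mul]
  have hint : ∫ t in (0 : ℝ)..1, iteratedDerivWithin n f (Set.Icc 0 1) t *
      iteratedDerivWithin (n + 4) g (Set.Icc 0 1) t ≤ 0 := by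
    rw [← neg_nonneg, ← intervalIntegral.integral_neg]
    exact intervalIntegral.integral_nonneg zero_le_one fun t ht => neg_nonneg.mpr
      (mul_nonpos_of_chgSign_mul_nonpos hx0 hxK hmono hsign ht (hga t ht))
  have hzero := mul_nonpos_of_chgSign_mul_nonpos hx0 hxK hmono hsign
    (Set.left_mem_Icc.mpr zero_le_one) hge
  have hone := mul_nonpos_of_chgSign_mul_nonpos hx0 hxK hmono hsign
    (c := -iteratedDerivWithin (n + 3) g (Set.Icc 0 1) 1)
    (Set.right_mem_Icc.mpr zero_le_one) (by rw [mul_neg]; exact neg_nonpos.mpr hgc)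
  rw [dualPairing, Finset.sum_range_succ, Finset.sum_range_succ, hsum, hparts, hgb, hgd]
  linarith
end
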